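/- Let s ∈ ℂ, let u ∈ S(1,s) be a Maass cusp form for SL₂(ℤ), and for a function v of the same kind define Pv(ζ) = ∫_0^∞ ( v(iy)(∂_x R_ζ^s)(iy) − R_ζ^s(iy)(∂_x v)(iy) ) dy for ζ > 0. For m ≥ 1 let H_m u(z) = Σ_{ad=m, a,d≥1, 0≤b<d} u((az+b)/d) and let H̃(m) = Σ_{d|m, 0≤b<d} M(b/d)·[[m/d, b],[0, d]]. Then for all ζ > 0: (Pu)|_s H̃(m) (ζ) = P(H_m u)(ζ); explicitly, Σ over all matrices [[a′,b′],[c′,d′]] occurring in H̃(m) of m^s (c′ζ+d′)^{−2s} Pu((a′ζ+b′)/(c′ζ+d′)) equals P(H_m u)(ζ). (The matrices occurring in H̃(m) are exactly the integer matrices [[a′,b′],[c′,d′]] with a′d′ − b′c′ = m, a′ > c′ ≥ 0 and d′ > b′ ≥ 0, each occurring once.) -/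

import Mathlib

noncomputable section

open Complex MeasureTheory

/- ## Farey machinery -/

/-- The Farey sequence of level `n`, as a subset of the extended reals;
`⊥ = -∞ = -1/0`, `⊤ = ∞ = 1/0`. -/
def fareySet (n : ℕ) : Set EReal :=
  {⊥, ⊤, 0} ∪ {x : EReal | ∃ q : ℚ, x = ((q : ℝ) : EReal) ∧ q.num.natAbs ≤ n ∧ q.den ≤ n}

/-- The level of an element of `ℚ ∪ {±∞}`. -/
def flev (x : EReal) : ℕ := sInf {n : ℕ | x ∈ fareySet n}

/-- The left neighbor map: the largest element of `F_{lev x}` strictly below `x`. -/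
def fLN (x : EReal) : EReal := sSup {r : EReal | r ∈ fareySet (flev x) ∧ r < x}

/-- The length `L` of the left neighbor sequence: the least `L` with `LN^L q = -∞`. -/
def fL (x : EReal) : ℕ := sInf {L : ℕ | fLN^[L] x = ⊥}

/-- The members `y_l = LN^{L-l}(q)` of the left neighbor sequence `LNS(q)`. -/
def yseq (q : ℚ) (l : ℕ) : EReal := fLN^[fL ((q : ℝ) : EReal) - l] ((q : ℝ) : EReal)

/-- The fraction `a/c` as an element of `ℚ ∪ {±∞}` (with `1/0 = ∞`, `-1/0 = -∞`). -/
def efrac (a c : ℤ) : EReal :=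
  if c = 0 then (if 0 < a then ⊤ else ⊥) else ((((a : ℚ) / (c : ℚ) : ℚ) : ℝ) : EReal)

open Classical in
/-- The numerator of an element of `ℚ ∪ {±∞}` in lowest terms (`-∞ = -1/0`, `∞ = 1/0`). -/
def enum (x : EReal) : ℤ :=
  if x = ⊥ then -1
  else if x = ⊤ then 1
  else if h : ∃ q : ℚ, x = ((q : ℝ) : EReal) then h.choose.num else 0

open Classical in
/-- The (nonnegative) denominator of an element of `ℚ ∪ {±∞}` in lowest terms. -/
def eden (x : EReal) : ℤ :=
  if x = ⊥ then 0
  else if x = ⊤ then 0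
  else if h : ∃ q : ℚ, x = ((q : ℝ) : EReal) then (h.choose.den : ℤ) else 0

/-- The matrix `m_l = [[b_l, -a_l], [b_{l-1}, -a_{l-1}]]` from `M(q) = Σ_l m_l`. -/
def mMat (q : ℚ) (l : ℕ) : Matrix (Fin 2) (Fin 2) ℤ :=
  !![eden (yseq q l), -enum (yseq q l); eden (yseq q (l - 1)), -enum (yseq q (l - 1))]

/- ## Matrix groups -/

abbrev SL2 := Matrix.SpecialLinearGroup (Fin 2) ℤ

/-- The Hecke congruence subgroup `Γ₀(n)` inside `SL₂(ℤ)`. -/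
def Gam0 (n : ℕ) : Set SL2 := {g : SL2 | (n : ℤ) ∣ (g : Matrix (Fin 2) (Fin 2) ℤ) 1 0}

/-- `X_m`: upper triangular integer matrices `[[a,b],[0,d]]` with `ad = m`, `d > b ≥ 0`. -/
def Xset (m : ℕ) : Set (Matrix (Fin 2) (Fin 2) ℤ) :=
  {A | A 1 0 = 0 ∧ A 0 0 * A 1 1 = (m : ℤ) ∧ 0 ≤ A 0 1 ∧ A 0 1 < A 1 1}

/-- `X_m` as a finite set. -/
def XF (m : ℕ) : Finset (Matrix (Fin 2) (Fin 2) ℤ) :=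
  ((m.divisors ×ˢ Finset.range m).filter fun p => p.2 < p.1).image
    fun p => !![((m / p.1 : ℕ) : ℤ), (p.2 : ℤ); 0, (p.1 : ℤ)]

/-- Möbius action of an integer matrix on (a suitable part of) `ℂ`. -/
def moeb (g : Matrix (Fin 2) (Fin 2) ℤ) (z : ℂ) : ℂ :=
  ((g 0 0 : ℂ) * z + (g 0 1 : ℂ)) / ((g 1 0 : ℂ) * z + (g 1 1 : ℂ))

/-- `α : Fin μ → SL₂(ℤ)` is a full set of representatives of the right cosets
`Γ₀(n) \ SL₂(ℤ)`. -/
def IsCosetReps (n : ℕ) {μ : ℕ} (α : Fin μ → SL2) : Prop :=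
  (∀ g : SL2, ∃ j : Fin μ, ∃ γ ∈ Gam0 n, g = γ * α j) ∧
  (∀ j k : Fin μ, (∃ γ ∈ Gam0 n, α j = γ * α k) → j = k)

open Classical in
/-- The representation of `SL₂(ℤ)` induced from the trivial representation of `Γ₀(n)`:
a permutation matrix realization of the right regular representation. -/
def rho (n : ℕ) {μ : ℕ} (α : Fin μ → SL2) (g : SL2) : Matrix (Fin μ) (Fin μ) ℂ :=
  fun i j => if α i * g * (α j)⁻¹ ∈ Gam0 n then 1 else 0

/- ## Analysis -/

/-- Partial derivative in the `x` (real) direction. -/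
def pdx (f : ℂ → ℂ) (z : ℂ) : ℂ := deriv (fun x : ℝ => f (x + z.im * Complex.I)) z.re

/-- Partial derivative in the `y` (imaginary) direction. -/
def pdy (f : ℂ → ℂ) (z : ℂ) : ℂ := deriv (fun y : ℝ => f (z.re + y * Complex.I)) z.im

/-- The hyperbolic Laplacian `Δ = -y²(∂_x² + ∂_y²)`. -/
def laplace (f : ℂ → ℂ) (z : ℂ) : ℂ := -(z.im : ℂ) ^ 2 * (pdx (pdx f) z + pdy (pdy f) z)

/-- `R_ζ(z) = Im z / |z - ζ|²`. -/
def Rfun (ζ : ℝ) (z : ℂ) : ℝ := z.im / ((z.re - ζ) ^ 2 + z.im ^ 2)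

/-- `R_ζ^s(z)`, using the principal branch on the positive real `R_ζ(z)`. -/
def Rpow (s : ℂ) (ζ : ℝ) (z : ℂ) : ℂ := ((Rfun ζ z : ℝ) : ℂ) ^ s

/-- A Maass cusp form for `Γ₀(n)` with spectral parameter `s`. -/
structure IsCuspForm (n : ℕ) (s : ℂ) (u : ℂ → ℂ) : Prop where
  analytic : AnalyticOnNhd ℝ u {z : ℂ | 0 < z.im}
  invar : ∀ g ∈ Gam0 n, ∀ z : ℂ, 0 < z.im → u (moeb g z) = u z
  eigen : ∀ z : ℂ, 0 < z.im → laplace u z = s * (1 - s) * u z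
  decay : ∀ g : SL2, ∀ C : ℝ, ∃ K T : ℝ, ∀ z : ℂ, 0 < z.im → T ≤ z.im →
    ‖u (moeb g z)‖ ≤ K * z.im ^ C

/-- A vector valued cusp form for `Γ₀(n)` with spectral parameter `s`. -/
structure IsVVCuspForm (n : ℕ) {μ : ℕ} (α : Fin μ → SL2) (s : ℂ) (U : ℂ → Fin μ → ℂ) :
    Prop where
  analytic : ∀ j, AnalyticOnNhd ℝ (fun z => U z j) {z : ℂ | 0 < z.im}
  equivar : ∀ g : SL2, ∀ z : ℂ, 0 < z.im → ∀ j,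
    U (moeb g z) j = ∑ k, rho n α g j k * U z k
  eigen : ∀ j, ∀ z : ℂ, 0 < z.im → laplace (fun w => U w j) z = s * (1 - s) * U z j
  decay : ∀ j, ∀ C : ℝ, ∃ K T : ℝ, ∀ z : ℂ, 0 < z.im → T ≤ z.im → ‖U z j‖ ≤ K * z.im ^ C

/-- The map `Π` from cusp forms to vector valued cusp forms. -/
def PiMap {μ : ℕ} (α : Fin μ → SL2) (u : ℂ → ℂ) : ℂ → Fin μ → ℂ :=
  fun z j => u (moeb (α j : Matrix (Fin 2) (Fin 2) ℤ) z)

/-- The integral transform `P`, componentwise: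
`(Pu)(ζ) = ∫_0^∞ (u(iy) ∂_x R_ζ^s(iy) - R_ζ^s(iy) ∂_x u(iy)) dy`. -/
def Ptrans (s : ℂ) (v : ℂ → ℂ) (ζ : ℝ) : ℂ :=
  ∫ y in Set.Ioi (0 : ℝ),
    (v (y * Complex.I) * pdx (Rpow s ζ) (y * Complex.I)
      - Rpow s ζ (y * Complex.I) * pdx v (y * Complex.I))

def Tmat : SL2 := ⟨!![1, 1; 0, 1], by norm_num [Matrix.det_fin_two_of]⟩

def Tmat' : SL2 := ⟨!![1, 0; 1, 1], by norm_num [Matrix.det_fin_two_of]⟩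

/-- A (vector valued) period function for `Γ₀(n)` with spectral parameter `s`. -/
structure IsPeriodFn (n : ℕ) {μ : ℕ} (α : Fin μ → SL2) (s : ℂ) (ψ : ℝ → Fin μ → ℂ) :
    Prop where
  analytic : ∀ i, AnalyticOnNhd ℝ (fun ζ => ψ ζ i) (Set.Ioi 0)
  threeterm : ∀ ζ : ℝ, 0 < ζ → ∀ i,
    ψ ζ i = ∑ k, rho n α Tmat⁻¹ i k * ψ (ζ + 1) k
      + ((ζ + 1 : ℝ) : ℂ) ^ (-(2 * s)) * ∑ k, rho n α Tmat'⁻¹ i k * ψ (ζ / (ζ + 1)) k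
  grow0 : ∀ i, ∃ K ε : ℝ, 0 < ε ∧ ∀ ζ : ℝ, 0 < ζ → ζ < ε →
    ‖ψ ζ i‖ ≤ K * ζ ^ (max 0 (-2 * s.re))
  growInf : ∀ i, ∃ K T : ℝ, ∀ ζ : ℝ, T ≤ ζ → 0 < ζ →
    ‖ψ ζ i‖ ≤ K * ζ ^ (min 0 (-2 * s.re))


/-- The summand `m^s (cζ+d)^{-2s} f((aζ+b)/(cζ+d))` of the weight-`2s` slash action of
a determinant-`m` integer matrix `B = [[a,b],[c,d]]` on a function `f` on `(0,∞)`. -/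
def slashTerm (s : ℂ) (m : ℕ) (f : ℝ → ℂ) (B : Matrix (Fin 2) (Fin 2) ℤ) (ζ : ℝ) : ℂ :=
  (m : ℂ) ^ s * (((B 1 0 : ℝ) * ζ + (B 1 1 : ℝ) : ℝ) : ℂ) ^ (-(2 * s))
    * f (((B 0 0 : ℝ) * ζ + (B 0 1 : ℝ)) / ((B 1 0 : ℝ) * ζ + (B 1 1 : ℝ)))

section

open Filter Topology

/- ## Left neighbor sequences -/

theorem ratCast_mem_fareySet {n : ℕ} {q : ℚ} :
    ((q : ℝ) : EReal) ∈ fareySet n ↔ q = 0 ∨ (q.num.natAbs ≤ n ∧ q.den ≤ n) := by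
  simp only [fareySet, Set.mem_union, Set.mem_insert_iff, Set.mem_singleton_iff,
    Set.mem_ofPred_eq, EReal.coe_ne_bot, EReal.coe_ne_top, false_or]
  constructor
  · rintro (h | ⟨p, hp, h⟩)
    · left; exact_mod_cast h
    · right
      have : q = p := by exact_mod_cast hp
      rwa [this]
  · rintro (rfl | h)
    · left; simp
    · exact Or.inr ⟨q, rfl, h⟩

theorem fLN_zero : fLN (((0 : ℚ) : ℝ) : EReal) = ⊥ := by
  have h0 : flev (((0 : ℚ) : ℝ) : EReal) = 0 :=
    Nat.le_zero.1 (Nat.sInf_le (ratCast_mem_fareySet.2 (Or.inl rfl)))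
  rw [fLN, h0, sSup_eq_bot]
  rintro x ⟨hx, hlt⟩
  rcases hx with (rfl | rfl | hx) | ⟨p, rfl, -, hp⟩
  · rfl
  · simp at hlt
  · rw [Set.mem_singleton_iff] at hx; simp [hx] at hlt
  · exact absurd p.den_pos (by omega)

theorem num_le_den {q : ℚ} (h1 : q < 1) : q.num < q.den := by
  have h := Rat.num_div_den q
  rw [← h, div_lt_one (by exact_mod_cast q.den_pos)] at h1
  exact_mod_cast h1

theorem flev_ratCast {q : ℚ} (h0 : 0 < q) (h1 : q < 1) : flev ((q : ℝ) : EReal) = q.den := by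
  have hn := Rat.num_pos.2 h0
  have hl := num_le_den h1
  apply le_antisymm
  · exact Nat.sInf_le (ratCast_mem_fareySet.2 (Or.inr ⟨by omega, le_rfl⟩))
  · have hm : flev ((q : ℝ) : EReal) ∈ {n : ℕ | ((q : ℝ) : EReal) ∈ fareySet n} :=
      Nat.sInf_mem ⟨q.den, ratCast_mem_fareySet.2 (Or.inr ⟨by omega, le_rfl⟩)⟩
    rcases ratCast_mem_fareySet.1 hm with h | h
    · exact absurd h h0.ne'
    · exact h.2

theorem exists_fLN {q : ℚ} (h0 : 0 < q) (h1 : q < 1) :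
    ∃ p : ℚ, 0 ≤ p ∧ p < q ∧ p.den < q.den ∧ q.num * p.den - p.num * q.den = 1 ∧
      fLN ((q : ℝ) : EReal) = ((p : ℝ) : EReal) := by
  have hn := Rat.num_pos.2 h0
  have hl := num_le_den h1
  have hd : (0 : ℤ) < q.den := by exact_mod_cast q.den_pos
  have hcop : IsCoprime q.num (q.den : ℤ) := by
    rw [Int.isCoprime_iff_nat_coprime]; simpa using q.reduced
  obtain ⟨x, y, hxy⟩ := hcop
  set b' : ℤ := x % q.den with hb'
  set a' : ℤ := -(y + q.num * (x / q.den)) with ha'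
  have hdet : q.num * b' - a' * q.den = 1 := by
    have := Int.emod_add_mul_ediv x q.den
    rw [ha', ← hxy]
    linear_combination q.num * this
  have hb0 : 0 ≤ b' := Int.emod_nonneg _ hd.ne'
  have hblt : b' < q.den := Int.emod_lt_of_pos _ hd
  have hbpos : 0 < b' := by
    rcases hb0.lt_or_eq with h | h
    · exact h
    · exfalso
      rw [← h] at hdet
      have : (q.den : ℤ) ∣ 1 := ⟨-a', by linarith⟩
      have := Int.le_of_dvd one_pos this
      omega
  have ha0 : 0 ≤ a' := by
    by_contra! h
    nlinarith [mul_pos hn hbpos]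
  have hab : a' < b' := by
    by_contra! h
    nlinarith [mul_le_mul_of_nonneg_right h hd.le]
  have hcop' : Nat.Coprime a'.natAbs b'.natAbs := by
    rw [← Int.isCoprime_iff_nat_coprime]
    exact ⟨-q.den, q.num, by linarith⟩
  set p : ℚ := (a' : ℚ) / (b' : ℚ) with hp
  have hpn : p.num = a' := Rat.num_div_eq_of_coprime hbpos hcop'
  have hpd : (p.den : ℤ) = b' := Rat.den_div_eq_of_coprime hbpos hcop'
  have hpq : p < q := by
    rw [Rat.lt_iff, hpn, hpd]; linarith
  refine ⟨p, ?_, hpq, by omega, by rw [hpn, hpd, hdet], ?_⟩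
  · exact div_nonneg (by exact_mod_cast ha0) (by exact_mod_cast hb0)
  rw [fLN, flev_ratCast h0 h1]
  refine IsGreatest.csSup_eq ⟨⟨ratCast_mem_fareySet.2 (Or.inr ⟨by omega, by omega⟩), ?_⟩, ?_⟩
  · exact_mod_cast hpq
  rintro r ⟨hr, hrq⟩
  have key : ∀ r : ℚ, r.den ≤ q.den → r < q → r ≤ p := by
    intro r hr1 hr2
    rw [Rat.lt_iff] at hr2
    rw [Rat.le_iff, hpn, hpd]
    by_contra! hc
    have hrd : (0 : ℤ) < r.den := by exact_mod_cast r.den_pos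
    have hr1' : (r.den : ℤ) ≤ q.den := by exact_mod_cast hr1
    have e : (r.den : ℤ) =
        b' * (q.num * r.den - r.num * q.den) + q.den * (r.num * b' - a' * r.den) := by
      linear_combination (-(r.den : ℤ)) * hdet
    nlinarith
  rcases hr with (rfl | rfl | hx) | ⟨r, rfl, -, hr⟩
  · exact bot_le
  · simp at hrq
  · rw [Set.mem_singleton_iff] at hx
    subst hx
    have := key 0 q.den_pos h0
    exact_mod_cast this
  · have := key r hr (by exact_mod_cast hrq)
    exact_mod_cast this

theorem enum_ratCast (q : ℚ) : enum ((q : ℝ) : EReal) = q.num := by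
  have h : ∃ p : ℚ, ((q : ℝ) : EReal) = ((p : ℝ) : EReal) := ⟨q, rfl⟩
  have hc : q = h.choose := by exact_mod_cast h.choose_spec
  rw [enum, if_neg (EReal.coe_ne_bot _), if_neg (EReal.coe_ne_top _), dif_pos h, ← hc]

theorem eden_ratCast (q : ℚ) : eden ((q : ℝ) : EReal) = q.den := by
  have h : ∃ p : ℚ, ((q : ℝ) : EReal) = ((p : ℝ) : EReal) := ⟨q, rfl⟩
  have hc : q = h.choose := by exact_mod_cast h.choose_spec
  rw [eden, if_neg (EReal.coe_ne_bot _), if_neg (EReal.coe_ne_top _), dif_pos h, ← hc]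

theorem fL_bot : fL ⊥ = 0 := Nat.le_zero.1 (Nat.sInf_le rfl)

theorem fL_eq_succ {x : EReal} (hx : x ≠ ⊥) (h : ∃ L : ℕ, fLN^[L] (fLN x) = ⊥) :
    fL x = fL (fLN x) + 1 := by
  apply le_antisymm
  · exact Nat.sInf_le (Nat.sInf_mem (s := {L : ℕ | fLN^[L] (fLN x) = ⊥}) h)
  · obtain ⟨L, hL⟩ := h
    have hm : fLN^[fL x] x = ⊥ := Nat.sInf_mem (s := {L : ℕ | fLN^[L] x = ⊥}) ⟨L + 1, hL⟩
    rcases hk : fL x with _ | k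
    · rw [hk] at hm; exact absurd hm hx
    · rw [hk] at hm
      exact Nat.succ_le_succ (Nat.sInf_le hm)

theorem yseq_fL (q : ℚ) : yseq q (fL ((q : ℝ) : EReal)) = ((q : ℝ) : EReal) := by
  simp [yseq]

theorem exists_iterate_fLN_eq_bot {q : ℚ} (h0 : 0 ≤ q) (h1 : q < 1) :
    ∃ L : ℕ, fLN^[L] ((q : ℝ) : EReal) = ⊥ := by
  induction hn : q.den using Nat.strong_induction_on generalizing q with
  | _ n ih =>
    rcases h0.eq_or_lt with rfl | h0
    · exact ⟨1, fLN_zero⟩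
    · obtain ⟨p, hp0, hpq, hpd, -, hp⟩ := exists_fLN h0 h1
      obtain ⟨L, hL⟩ := ih p.den (hn ▸ hpd) hp0 (hpq.trans h1) rfl
      exact ⟨L + 1, by rw [Function.iterate_succ_apply, hp, hL]⟩

/-- A sum over `M(q)` telescopes when its summand is a difference of the values of a function at
the rows of the matrix. -/
theorem sum_mMat_eq_sub {q₀ : ℚ} (h0 : 0 ≤ q₀) (f : Matrix (Fin 2) (Fin 2) ℤ → ℂ)
    (Λ : ℤ → ℤ → ℂ)
    (h : ∀ a b a' b' : ℤ, 0 < b → 0 ≤ b' → a * b' - a' * b = 1 → (a : ℚ) ≤ q₀ * b →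
      (a' : ℚ) ≤ q₀ * b' → f !![b, -a; b', -a'] = Λ b' (-a') - Λ b (-a))
    {q : ℚ} (hq0 : 0 ≤ q) (hq1 : q < 1) (hq : q ≤ q₀) :
    ∑ l ∈ Finset.Icc 1 (fL ((q : ℝ) : EReal)), f (mMat q l) = Λ 0 1 - Λ q.den (-q.num) := by
  have num_le : ∀ {r : ℚ}, r ≤ q₀ → (r.num : ℚ) ≤ q₀ * (r.den : ℤ) := by
    intro r hr
    have hd : (0 : ℚ) < r.den := by exact_mod_cast r.den_pos
    rw [← Rat.num_div_den r, div_le_iff₀ hd] at hr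
    exact_mod_cast hr
  induction hn : q.den using Nat.strong_induction_on generalizing q with
  | _ n ih =>
    subst hn
    rcases hq0.eq_or_lt with rfl | hq0
    · have hL : fL (((0 : ℚ) : ℝ) : EReal) = 1 := by
        rw [fL_eq_succ (EReal.coe_ne_bot _) ⟨0, fLN_zero⟩, fLN_zero, fL_bot]
      have hm : mMat 0 1 = !![1, -0; 0, -(-1)] := by
        have e1 := yseq_fL 0
        rw [hL] at e1
        have e0 : yseq 0 0 = ⊥ := by
          rw [yseq, hL]; exact fLN_zero
        rw [mMat, e1, Nat.sub_self, e0, enum_ratCast, eden_ratCast]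
        simp [enum, eden]
      rw [hL, Finset.Icc_self, Finset.sum_singleton, hm,
        h 0 1 (-1) 0 one_pos le_rfl (by norm_num) (by simpa using h0) (by simp)]
      simp
    · obtain ⟨p, hp0, hpq, hpd, hdet, hp⟩ := exists_fLN hq0 hq1
      have hp1 := hpq.trans hq1
      have hL : fL ((q : ℝ) : EReal) = fL ((p : ℝ) : EReal) + 1 := by
        rw [fL_eq_succ (EReal.coe_ne_bot _) (by rw [hp]; exact exists_iterate_fLN_eq_bot hp0 hp1),
          hp]
      have hy : ∀ l ≤ fL ((p : ℝ) : EReal), yseq q l = yseq p l := by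
        intro l hl
        rw [yseq, yseq, hL, Nat.sub_add_comm hl, Function.iterate_succ_apply, hp]
      rw [hL, Finset.sum_Icc_succ_top (by omega)]
      have hs : ∑ l ∈ Finset.Icc 1 (fL ((p : ℝ) : EReal)), f (mMat q l) =
          ∑ l ∈ Finset.Icc 1 (fL ((p : ℝ) : EReal)), f (mMat p l) := by
        refine Finset.sum_congr rfl fun l hl => ?_
        rw [Finset.mem_Icc] at hl
        rw [mMat, mMat, hy l hl.2, hy (l - 1) (by omega)]
      have hm : mMat q (fL ((p : ℝ) : EReal) + 1) =
          !![(q.den : ℤ), -q.num; (p.den : ℤ), -p.num] := by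
        have e1 := yseq_fL q
        rw [hL] at e1
        rw [mMat, e1, Nat.add_sub_cancel, hy _ le_rfl, yseq_fL, enum_ratCast, eden_ratCast,
          enum_ratCast, eden_ratCast]
      rw [hs, ih p.den hpd hp0 hp1 (hpq.le.trans hq) rfl, hm,
        h q.num q.den p.num p.den (by exact_mod_cast q.den_pos) (by positivity) hdet
          (num_le hq) (num_le (hpq.le.trans hq))]
      ring

/- ## An interior gradient estimate for the Poisson equation -/

open Filter Topology in
theorem IsLocalMax.second_deriv_nonpos {h h' : ℝ → ℝ} {h'' x : ℝ} (hmax : IsLocalMax h x)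
    (h1 : ∀ᶠ y in 𝓝 x, HasDerivAt h (h' y) y) (h2 : HasDerivAt h' h'' x) : h'' ≤ 0 := by
  by_contra! hpos
  have hd : deriv h =ᶠ[𝓝 x] h' := h1.mono fun y hy => hy.deriv
  have hdd : deriv (deriv h) x = h'' := by rw [hd.deriv_eq, h2.deriv]
  have hmin := isLocalMin_of_deriv_deriv_pos (hdd ▸ hpos) hmax.deriv_eq_zero
    h1.self_of_nhds.continuousAt
  have hconst : h =ᶠ[𝓝 x] fun _ => h x := by
    filter_upwards [hmax, hmin] with y hy1 hy2 using le_antisymm hy1 hy2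
  have h0 : deriv (deriv h) x = 0 := by
    rw [hconst.deriv.deriv_eq]; simp
  linarith

open Filter Topology in
theorem HasDerivAt.nonpos_of_nonpos_right {h : ℝ → ℝ} {h' : ℝ} (hd : HasDerivAt h h' 0)
    (h0 : h 0 = 0) (hle : ∀ p ∈ Set.Icc (0 : ℝ) 1, h p ≤ 0) : h' ≤ 0 := by
  have ht := (hasDerivWithinAt_iff_tendsto_slope' (Set.self_notMem_Ioi)).1
    (hd.hasDerivWithinAt (s := Set.Ioi 0))
  refine le_of_tendsto ht ?_
  filter_upwards [Ioo_mem_nhdsGT one_pos] with p hp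
  rw [slope_def_field, h0, sub_zero, sub_zero]
  exact div_nonpos_of_nonpos_of_nonneg (hle p ⟨hp.1.le, hp.2.le⟩) hp.1.le

open Filter Topology in
/-- One-sided gradient estimate at the centre of a square, by comparison with a barrier. -/
theorem partialDeriv_le_of_laplacian_lt {w wp wpp wt wtt : ℝ → ℝ → ℝ} {M N : ℝ}
    (hc : ContinuousOn (Function.uncurry w) (Set.Icc (-1) 1 ×ˢ Set.Icc (-1) 1))
    (hp : ∀ p ∈ Set.Ioo (-1 : ℝ) 1, ∀ t ∈ Set.Ioo (-1 : ℝ) 1,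
      HasDerivAt (fun p => w p t) (wp p t) p)
    (hpp : ∀ p ∈ Set.Ioo (-1 : ℝ) 1, ∀ t ∈ Set.Ioo (-1 : ℝ) 1,
      HasDerivAt (fun p => wp p t) (wpp p t) p)
    (ht : ∀ p ∈ Set.Ioo (-1 : ℝ) 1, ∀ t ∈ Set.Ioo (-1 : ℝ) 1, HasDerivAt (w p) (wt p t) t)
    (htt : ∀ p ∈ Set.Ioo (-1 : ℝ) 1, ∀ t ∈ Set.Ioo (-1 : ℝ) 1, HasDerivAt (wt p) (wtt p t) t)
    (hM : ∀ p ∈ Set.Icc (-1 : ℝ) 1, ∀ t ∈ Set.Icc (-1 : ℝ) 1, |w p t| ≤ M)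
    (hN : ∀ p ∈ Set.Ioo (-1 : ℝ) 1, ∀ t ∈ Set.Ioo (-1 : ℝ) 1, |wpp p t + wtt p t| < N) :
    wp 0 0 ≤ 2 * M + N / 2 := by
  have h00 : (0 : ℝ) ∈ Set.Icc (-1 : ℝ) 1 := by norm_num
  have h00' : (0 : ℝ) ∈ Set.Ioo (-1 : ℝ) 1 := by norm_num
  have hM0 : 0 ≤ M := (abs_nonneg _).trans (hM 0 h00 0 h00)
  have hN0 : 0 < N := (abs_nonneg _).trans_lt (hN 0 h00' 0 h00')
  set D : ℝ → ℝ → ℝ := fun p t =>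
    (w p t - w (-p) t) / 2 - (M * (t ^ 2 + p * (2 - p)) + N * (p * (1 - p)) / 2) with hD
  set K : Set (ℝ × ℝ) := Set.Icc 0 1 ×ˢ Set.Icc (-1) 1 with hK
  have hKc : IsCompact K := isCompact_Icc.prod isCompact_Icc
  have hneg : ∀ p ∈ Set.Icc (0 : ℝ) 1, p ∈ Set.Icc (-1 : ℝ) 1 ∧ -p ∈ Set.Icc (-1 : ℝ) 1 :=
    fun p hp => ⟨⟨by linarith [hp.1], hp.2⟩, ⟨by linarith [hp.2], by linarith [hp.1]⟩⟩
  have hDc : ContinuousOn (Function.uncurry D) K := by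
    have e1 : ContinuousOn (fun x : ℝ × ℝ => w x.1 x.2) K :=
      hc.mono (Set.prod_mono (fun p hp => (hneg p hp).1) le_rfl)
    have e2 : ContinuousOn (fun x : ℝ × ℝ => w (-x.1) x.2) K :=
      hc.comp (f := fun x : ℝ × ℝ => (-x.1, x.2)) (by fun_prop)
        fun x hx => ⟨(hneg _ hx.1).2, hx.2⟩
    have e3 : ContinuousOn (fun x : ℝ × ℝ =>
      M * (x.2 ^ 2 + x.1 * (2 - x.1)) + N * (x.1 * (1 - x.1)) / 2) K := by fun_prop
    exact ((e1.sub e2).div_const 2).sub e3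
  have hDle : ∀ p ∈ Set.Icc (0 : ℝ) 1, ∀ t ∈ Set.Icc (-1 : ℝ) 1, D p t ≤ 0 := by
    obtain ⟨⟨a, b⟩, hab, hmax⟩ := hKc.exists_isMaxOn ⟨(0, 0), by norm_num [hK]⟩ hDc
    suffices D a b ≤ 0 from fun p hp t ht => (hmax (a := (p, t)) ⟨hp, ht⟩).trans this
    obtain ⟨ha, hb⟩ := hab
    simp only at ha hb
    have hwle : (w a b - w (-a) b) / 2 ≤ M := by
      have e1 := (abs_le.1 (hM a (hneg a ha).1 b hb)).2
      have e2 := (abs_le.1 (hM (-a) (hneg a ha).2 b hb)).1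
      linarith
    have hNa : 0 ≤ N * (a * (1 - a)) :=
      mul_nonneg hN0.le (mul_nonneg ha.1 (by linarith [ha.2]))
    have haa : 0 ≤ a * (2 - a) := mul_nonneg ha.1 (by linarith [ha.2])
    rcases ha.1.eq_or_lt with h | ha0
    · subst h
      simp only [hD]
      nlinarith [mul_nonneg hM0 (sq_nonneg b), neg_zero (G := ℝ)]
    rcases ha.2.eq_or_lt with h | ha1
    · subst h
      simp only [hD]
      nlinarith [mul_nonneg hM0 (sq_nonneg b)]
    rcases hb.1.eq_or_lt with h | hb0
    · subst h
      simp only [hD]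
      nlinarith [mul_nonneg hM0 haa]
    rcases hb.2.eq_or_lt with h | hb1
    · subst h
      simp only [hD]
      nlinarith [mul_nonneg hM0 haa]
    exfalso
    have hmem : ∀ p ∈ Set.Ioo (0 : ℝ) 1, p ∈ Set.Ioo (-1 : ℝ) 1 ∧ -p ∈ Set.Ioo (-1 : ℝ) 1 :=
      fun p hp => ⟨⟨by linarith [hp.1], hp.2⟩, ⟨by linarith [hp.2], by linarith [hp.1]⟩⟩
    have na := Ioo_mem_nhds ha0 ha1
    have nb := Ioo_mem_nhds hb0 hb1
    have hpmax : IsLocalMax (fun p => D p b) a := by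
      filter_upwards [na] with p hp
      exact hmax (a := (p, b)) ⟨⟨hp.1.le, hp.2.le⟩, hb⟩
    have htmax : IsLocalMax (D a) b := by
      filter_upwards [nb] with t ht
      exact hmax (a := (a, t)) ⟨ha, ⟨ht.1.le, ht.2.le⟩⟩
    have hb' : b ∈ Set.Ioo (-1 : ℝ) 1 := ⟨hb0, hb1⟩
    have ha' := hmem a ⟨ha0, ha1⟩
    have k1 := hpmax.second_deriv_nonpos
      (h' := fun p => (wp p b + wp (-p) b) / 2 - (M * (2 - 2 * p) + N * (1 - 2 * p) / 2))
      (h'' := (wpp a b - wpp (-a) b) / 2 - (M * (-2) + N * (-2) / 2))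
      (by
        filter_upwards [na] with p hp'
        have d1 := hp p (hmem p hp').1 b hb'
        have d2 := (hp (-p) (hmem p hp').2 b hb').comp p (hasDerivAt_neg p)
        have d3 : HasDerivAt (fun p => M * (b ^ 2 + p * (2 - p)) + N * (p * (1 - p)) / 2)
            (M * (2 - 2 * p) + N * (1 - 2 * p) / 2) p := by
          have e1 := ((hasDerivAt_id p).mul ((hasDerivAt_id p).const_sub 2)).const_add (b ^ 2)
          have e2 := ((hasDerivAt_id p).mul ((hasDerivAt_id p).const_sub 1))
          refine ((e1.const_mul M).add ((e2.const_mul N).div_const 2)).congr_deriv ?_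
          simp; ring
        refine (((d1.sub d2).div_const 2).sub d3).congr_deriv ?_
        ring)
      (by
        have d1 := hpp a ha'.1 b hb'
        have d2 := (hpp (-a) ha'.2 b hb').comp a (hasDerivAt_neg a)
        have d3 : HasDerivAt (fun p => M * (2 - 2 * p) + N * (1 - 2 * p) / 2)
            (M * (-2) + N * (-2) / 2) a := by
          have e1 := ((hasDerivAt_id a).const_mul 2).const_sub 2
          have e2 := ((hasDerivAt_id a).const_mul 2).const_sub 1
          refine ((e1.const_mul M).add ((e2.const_mul N).div_const 2)).congr_deriv ?_
          simp
        refine (((d1.add d2).div_const 2).sub d3).congr_deriv ?_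
        ring)
    have k2 := htmax.second_deriv_nonpos
      (h' := fun t => (wt a t - wt (-a) t) / 2 - M * (2 * t))
      (h'' := (wtt a b - wtt (-a) b) / 2 - M * 2)
      (by
        filter_upwards [nb] with t ht'
        have d1 := ht a ha'.1 t ht'
        have d2 := ht (-a) ha'.2 t ht'
        have d3 : HasDerivAt (fun t => M * (t ^ 2 + a * (2 - a)) + N * (a * (1 - a)) / 2)
            (M * (2 * t)) t := by
          have e1 := ((hasDerivAt_pow 2 t).add_const (a * (2 - a))).const_mul M
          refine (e1.add_const (N * (a * (1 - a)) / 2)).congr_deriv ?_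
          simp
        exact ((d1.sub d2).div_const 2).sub d3)
      (by
        have d1 := htt a ha'.1 b hb'
        have d2 := htt (-a) ha'.2 b hb'
        have d3 : HasDerivAt (fun t => M * (2 * t)) (M * 2) b := by
          have e1 := ((hasDerivAt_id b).const_mul 2).const_mul M
          refine e1.congr_deriv ?_
          simp
        exact ((d1.sub d2).div_const 2).sub d3)
    have n1 := abs_lt.1 (hN a ha'.1 b hb')
    have n2 := abs_lt.1 (hN (-a) ha'.2 b hb')
    linarith [n1.1, n2.2]
  have hD0 : HasDerivAt (fun p => D p 0) (wp 0 0 - (2 * M + N / 2)) 0 := by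
    have d1 := hp 0 h00' 0 h00'
    have d2 : HasDerivAt (fun p => w (-p) 0) (wp 0 0 * -1) 0 := by
      have := hp (-0) (by simp) 0 h00'
      rw [neg_zero] at this
      have h' : HasDerivAt (fun p => w p 0) (wp 0 0) (-0) := by rwa [neg_zero]
      exact h'.comp (0 : ℝ) (hasDerivAt_neg (0 : ℝ))
    have d3 : HasDerivAt (fun p : ℝ => M * (0 ^ 2 + p * (2 - p)) + N * (p * (1 - p)) / 2)
        (2 * M + N / 2) 0 := by
      have e1 := ((hasDerivAt_id (0 : ℝ)).mul ((hasDerivAt_id (0 : ℝ)).const_sub 2)).const_add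
        ((0 : ℝ) ^ 2)
      have e2 := ((hasDerivAt_id (0 : ℝ)).mul ((hasDerivAt_id (0 : ℝ)).const_sub 1))
      refine ((e1.const_mul M).add ((e2.const_mul N).div_const 2)).congr_deriv ?_
      simp; ring
    refine (((d1.sub d2).div_const 2).sub d3).congr_deriv ?_
    ring
  have := hD0.nonpos_of_nonpos_right (by simp [hD]) fun p hp => hDle p hp 0 h00
  linarith

/-- Interior gradient estimate at the centre of a square. -/
theorem abs_partialDeriv_le_of_laplacian_lt {w wp wpp wt wtt : ℝ → ℝ → ℝ} {M N : ℝ}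
    (hc : ContinuousOn (Function.uncurry w) (Set.Icc (-1) 1 ×ˢ Set.Icc (-1) 1))
    (hp : ∀ p ∈ Set.Ioo (-1 : ℝ) 1, ∀ t ∈ Set.Ioo (-1 : ℝ) 1,
      HasDerivAt (fun p => w p t) (wp p t) p)
    (hpp : ∀ p ∈ Set.Ioo (-1 : ℝ) 1, ∀ t ∈ Set.Ioo (-1 : ℝ) 1,
      HasDerivAt (fun p => wp p t) (wpp p t) p)
    (ht : ∀ p ∈ Set.Ioo (-1 : ℝ) 1, ∀ t ∈ Set.Ioo (-1 : ℝ) 1, HasDerivAt (w p) (wt p t) t)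
    (htt : ∀ p ∈ Set.Ioo (-1 : ℝ) 1, ∀ t ∈ Set.Ioo (-1 : ℝ) 1, HasDerivAt (wt p) (wtt p t) t)
    (hM : ∀ p ∈ Set.Icc (-1 : ℝ) 1, ∀ t ∈ Set.Icc (-1 : ℝ) 1, |w p t| ≤ M)
    (hN : ∀ p ∈ Set.Ioo (-1 : ℝ) 1, ∀ t ∈ Set.Ioo (-1 : ℝ) 1, |wpp p t + wtt p t| < N) :
    |wp 0 0| ≤ 2 * M + N / 2 := by
  refine abs_le.2 ⟨?_, partialDeriv_le_of_laplacian_lt hc hp hpp ht htt hM hN⟩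
  have := partialDeriv_le_of_laplacian_lt (w := fun p t => -w p t) (wp := fun p t => -wp p t)
    (wpp := fun p t => -wpp p t) (wt := fun p t => -wt p t) (wtt := fun p t => -wtt p t)
    hc.neg (fun p hp' t ht' => (hp p hp' t ht').neg) (fun p hp' t ht' => (hpp p hp' t ht').neg)
    (fun p hp' t ht' => (ht p hp' t ht').neg) (fun p hp' t ht' => (htt p hp' t ht').neg)
    (fun p hp' t ht' => by rw [abs_neg]; exact hM p hp' t ht')
    (fun p hp' t ht' => by rw [← neg_add, abs_neg]; exact hN p hp' t ht')
  linarith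

/- ## Partial derivatives on the upper half-plane -/

/-- The upper half-plane as a subset of `ℂ`. -/
def upperHalf : Set ℂ := {z : ℂ | 0 < z.im}

theorem isOpen_upperHalf : IsOpen upperHalf := isOpen_lt continuous_const continuous_im

theorem convex_upperHalf : Convex ℝ upperHalf := convex_halfSpace_im_gt 0

theorem hasDerivAt_comp_line {E : Type*} [NormedAddCommGroup E] [NormedSpace ℝ E] {f : ℂ → E}
    {z e : ℂ} {t : ℝ} (hf : DifferentiableAt ℝ f (z + t * e)) :
    HasDerivAt (fun x : ℝ => f (z + x * e)) (fderiv ℝ f (z + t * e) e) t := by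
  have h : HasDerivAt (fun x : ℝ => z + (x : ℂ) * e) e t := by
    simpa using ((hasDerivAt_id t).ofReal_comp.mul_const e).const_add z
  exact hf.hasFDerivAt.comp_hasDerivAt t h

theorem pdx_eq_fderiv {f : ℂ → ℂ} {z : ℂ} (hf : DifferentiableAt ℝ f z) :
    pdx f z = fderiv ℝ f z 1 := by
  have hz : (z.im * I + (z.re : ℝ) * 1 : ℂ) = z := by
    rw [mul_one, add_comm]; exact re_add_im z
  have h := hasDerivAt_comp_line (f := f) (z := z.im * I) (e := 1) (t := z.re) (by rwa [hz])
  rw [hz] at h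
  rw [pdx, ← h.deriv]
  congr 1
  ext x
  rw [mul_one, add_comm]

theorem pdy_eq_fderiv {f : ℂ → ℂ} {z : ℂ} (hf : DifferentiableAt ℝ f z) :
    pdy f z = fderiv ℝ f z I := by
  have h := hasDerivAt_comp_line (f := f) (z := z.re) (e := I) (t := z.im) (by rwa [re_add_im])
  rw [re_add_im] at h
  exact h.deriv

theorem laplace_eq_fderiv {f : ℂ → ℂ} (hf : ContDiffOn ℝ 2 f upperHalf) {z : ℂ}
    (hz : z ∈ upperHalf) :
    laplace f z = -(z.im : ℂ) ^ 2 *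
      (fderiv ℝ (fderiv ℝ f) z 1 1 + fderiv ℝ (fderiv ℝ f) z I I) := by
  have hn := isOpen_upperHalf.mem_nhds hz
  have h1 : ∀ w ∈ upperHalf, DifferentiableAt ℝ f w := fun w hw =>
    (hf.contDiffAt (isOpen_upperHalf.mem_nhds hw)).differentiableAt (by norm_num)
  have h2 : DifferentiableAt ℝ (fderiv ℝ f) z :=
    ((hf.contDiffAt hn).fderiv_right (m := 1) (by norm_num)).differentiableAt (by norm_num)
  have key : ∀ e : ℂ, fderiv ℝ (fun w => fderiv ℝ f w e) z e = fderiv ℝ (fderiv ℝ f) z e e := by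
    intro e
    rw [fderiv_clm_apply h2 (differentiableAt_const e)]
    simp
  have d : ∀ e : ℂ, DifferentiableAt ℝ (fun w => fderiv ℝ f w e) z := fun e =>
    h2.clm_apply (differentiableAt_const e)
  have ex : pdx f =ᶠ[𝓝 z] fun w => fderiv ℝ f w 1 := by
    filter_upwards [hn] with w hw using pdx_eq_fderiv (h1 w hw)
  have ey : pdy f =ᶠ[𝓝 z] fun w => fderiv ℝ f w I := by
    filter_upwards [hn] with w hw using pdy_eq_fderiv (h1 w hw)
  rw [laplace, pdx_eq_fderiv (ex.differentiableAt_iff.2 (d 1)),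
    pdy_eq_fderiv (ey.differentiableAt_iff.2 (d I)), ex.fderiv_eq, ey.fderiv_eq, key, key]

theorem IsCuspForm.contDiffOn {n : ℕ} {s : ℂ} {u : ℂ → ℂ} (hu : IsCuspForm n s u) :
    ContDiffOn ℝ 2 u upperHalf :=
  hu.analytic.contDiffOn isOpen_upperHalf.uniqueDiffOn

/-- Gradient estimate for eigenfunctions of the Laplacian, in the direction `e`. -/
theorem abs_re_fderiv_le {u : ℂ → ℂ} {lam : ℂ} (hu : ContDiffOn ℝ 2 u upperHalf)
    (heig : ∀ z ∈ upperHalf, laplace u z = lam * u z) {z₀ : ℂ} (hz₀ : 2 ≤ z₀.im) {M : ℝ}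
    (hM0 : 0 < M)
    (hM : ∀ z : ℂ, z₀.im - 1 ≤ z.im → ‖u z‖ ≤ M) {e e' : ℂ}
    (he : (e = 1 ∧ e' = I) ∨ (e = I ∧ e' = 1)) (ℓ : ℂ →L[ℝ] ℝ) (hℓ : ∀ z, |ℓ z| ≤ ‖z‖) :
    |ℓ (fderiv ℝ u z₀ e)| ≤ (‖lam‖ + 3) * M := by
  have him : ∀ p ∈ Set.Icc (-1 : ℝ) 1, ∀ t ∈ Set.Icc (-1 : ℝ) 1,
      z₀.im - 1 ≤ (z₀ + p * e + t * e').im := by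
    intro p hp t ht
    rcases he with ⟨rfl, rfl⟩ | ⟨rfl, rfl⟩
    · simp; linarith [ht.1]
    · simp; linarith [hp.1]
  have hmem : ∀ p ∈ Set.Icc (-1 : ℝ) 1, ∀ t ∈ Set.Icc (-1 : ℝ) 1,
      z₀ + p * e + t * e' ∈ upperHalf := fun p hp t ht => by
    have := him p hp t ht
    show 0 < (z₀ + p * e + t * e').im
    linarith
  have hI : ∀ {p : ℝ}, p ∈ Set.Ioo (-1 : ℝ) 1 → p ∈ Set.Icc (-1 : ℝ) 1 :=
    fun h => Set.Ioo_subset_Icc_self h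
  have hca : ∀ w ∈ upperHalf, ContDiffAt ℝ 2 u w := fun w hw =>
    hu.contDiffAt (isOpen_upperHalf.mem_nhds hw)
  have h1 : ∀ w ∈ upperHalf, DifferentiableAt ℝ u w := fun w hw =>
    (hca w hw).differentiableAt (by norm_num)
  have h2 : ∀ w ∈ upperHalf, DifferentiableAt ℝ (fderiv ℝ u) w := fun w hw =>
    ((hca w hw).fderiv_right (m := 1) (by norm_num)).differentiableAt (by norm_num)
  have line2 : ∀ (z d : ℂ) (t : ℝ), z + t * d ∈ upperHalf →
      HasDerivAt (fun x : ℝ => ℓ (fderiv ℝ u (z + x * d) d))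
        (ℓ (fderiv ℝ (fderiv ℝ u) (z + t * d) d d)) t := fun z d t h =>
    ℓ.hasFDerivAt.comp_hasDerivAt t
      ((hasDerivAt_comp_line (h2 _ h)).clm_apply (hasDerivAt_const t d) |>.congr_deriv (by simp))
  have line1 : ∀ (z d : ℂ) (t : ℝ), z + t * d ∈ upperHalf →
      HasDerivAt (fun x : ℝ => ℓ (u (z + x * d))) (ℓ (fderiv ℝ u (z + t * d) d)) t :=
    fun z d t h => ℓ.hasFDerivAt.comp_hasDerivAt t (hasDerivAt_comp_line (h1 _ h))
  have hsw : ∀ p t : ℝ, z₀ + p * e + t * e' = z₀ + t * e' + p * e := fun p t => by ring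
  have main := abs_partialDeriv_le_of_laplacian_lt
    (w := fun p t => ℓ (u (z₀ + p * e + t * e')))
    (wp := fun p t => ℓ (fderiv ℝ u (z₀ + p * e + t * e') e))
    (wpp := fun p t => ℓ (fderiv ℝ (fderiv ℝ u) (z₀ + p * e + t * e') e e))
    (wt := fun p t => ℓ (fderiv ℝ u (z₀ + p * e + t * e') e'))
    (wtt := fun p t => ℓ (fderiv ℝ (fderiv ℝ u) (z₀ + p * e + t * e') e' e'))
    (M := M) (N := (‖lam‖ + 1) * M) ?_ ?_ ?_ ?_ ?_ ?_ ?_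
  · simp only [ofReal_zero, zero_mul, add_zero] at main
    refine main.trans ?_
    nlinarith [norm_nonneg lam, mul_nonneg (norm_nonneg lam) hM0.le]
  · refine ℓ.continuous.comp_continuousOn ?_
    refine (hu.continuousOn).comp (f := fun x : ℝ × ℝ => z₀ + x.1 * e + x.2 * e')
      (by fun_prop) fun x hx => hmem _ hx.1 _ hx.2
  · intro p hp t ht
    have h := line1 (z₀ + t * e') e p (by rw [← hsw]; exact hmem p (hI hp) t (hI ht))
    simpa only [← hsw] using h
  · intro p hp t ht
    have h := line2 (z₀ + t * e') e p (by rw [← hsw]; exact hmem p (hI hp) t (hI ht))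
    simpa only [← hsw] using h
  · exact fun p hp t ht => line1 (z₀ + p * e) e' t (hmem p (hI hp) t (hI ht))
  · exact fun p hp t ht => line2 (z₀ + p * e) e' t (hmem p (hI hp) t (hI ht))
  · exact fun p hp t ht => (hℓ _).trans (hM _ (him p hp t ht))
  · intro p hp t ht
    set w := z₀ + p * e + t * e' with hw
    have hwm : w ∈ upperHalf := hmem p (hI hp) t (hI ht)
    have hwi : 1 ≤ w.im := by linarith [him p (hI hp) t (hI ht)]
    have hl := (laplace_eq_fderiv hu hwm).symm.trans (heig w hwm)
    have hsum : fderiv ℝ (fderiv ℝ u) w e e + fderiv ℝ (fderiv ℝ u) w e' e' =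
        fderiv ℝ (fderiv ℝ u) w 1 1 + fderiv ℝ (fderiv ℝ u) w I I := by
      rcases he with ⟨rfl, rfl⟩ | ⟨rfl, rfl⟩
      · rfl
      · rw [add_comm]
    rw [← map_add, hsum]
    refine (hℓ _).trans_lt ?_
    have hnorm := congrArg norm hl
    rw [norm_mul, norm_mul, norm_neg, norm_pow, norm_real, Real.norm_of_nonneg (by linarith)]
      at hnorm
    have hle : ‖fderiv ℝ (fderiv ℝ u) w 1 1 + fderiv ℝ (fderiv ℝ u) w I I‖ ≤ ‖lam‖ * ‖u w‖ := by
      rw [← hnorm]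
      exact le_mul_of_one_le_left (norm_nonneg _) (one_le_pow₀ hwi)
    have := mul_le_mul_of_nonneg_left (hM w (him p (hI hp) t (hI ht))) (norm_nonneg lam)
    linarith

theorem norm_fderiv_le_of_eigen {u : ℂ → ℂ} {lam : ℂ} (hu : ContDiffOn ℝ 2 u upperHalf)
    (heig : ∀ z ∈ upperHalf, laplace u z = lam * u z) {z₀ : ℂ} (hz₀ : 2 ≤ z₀.im) {M : ℝ}
    (hM0 : 0 < M) (hM : ∀ z : ℂ, z₀.im - 1 ≤ z.im → ‖u z‖ ≤ M) :
    ‖fderiv ℝ u z₀ 1‖ ≤ 2 * (‖lam‖ + 3) * M ∧ ‖fderiv ℝ u z₀ I‖ ≤ 2 * (‖lam‖ + 3) * M := by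
  have key : ∀ e e' : ℂ, ((e = 1 ∧ e' = I) ∨ (e = I ∧ e' = 1)) →
      ‖fderiv ℝ u z₀ e‖ ≤ 2 * (‖lam‖ + 3) * M := by
    intro e e' he
    have h1 := abs_re_fderiv_le hu heig hz₀ hM0 hM he reCLM abs_re_le_norm
    have h2 := abs_re_fderiv_le hu heig hz₀ hM0 hM he imCLM abs_im_le_norm
    refine (norm_le_abs_re_add_abs_im _).trans ?_
    rw [reCLM_apply] at h1
    rw [imCLM_apply] at h2
    linarith
  exact ⟨key 1 I (Or.inl ⟨rfl, rfl⟩), key I 1 (Or.inr ⟨rfl, rfl⟩)⟩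

/-- Cusp forms and their first derivatives decay rapidly at the cusp `∞`. -/
theorem IsCuspForm.exists_decay {n : ℕ} {s : ℂ} {u : ℂ → ℂ} (hu : IsCuspForm n s u) {C : ℝ}
    (hC : 0 ≤ C) :
    ∃ K T : ℝ, 0 < K ∧ 1 ≤ T ∧ ∀ z : ℂ, T ≤ z.im → ‖u z‖ ≤ K * z.im ^ (-C) ∧
      ‖fderiv ℝ u z 1‖ ≤ K * z.im ^ (-C) ∧ ‖fderiv ℝ u z I‖ ≤ K * z.im ^ (-C) := by
  obtain ⟨K₀, T₀, h₀⟩ := hu.decay 1 (-C)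
  set K := max K₀ 1 with hK
  have hK1 : 1 ≤ K := le_max_right _ _
  set T := max T₀ 1 with hT
  have hT1 : 1 ≤ T := le_max_right _ _
  have h : ∀ z : ℂ, T ≤ z.im → ‖u z‖ ≤ K * z.im ^ (-C) := by
    intro z hz
    have hz0 : 0 < z.im := by linarith
    have := h₀ z hz0 ((le_max_left _ _).trans hz)
    have hm : moeb (1 : SL2) z = z := by simp [moeb]
    rw [hm] at this
    exact this.trans (mul_le_mul_of_nonneg_right (le_max_left _ _) (Real.rpow_nonneg hz0.le _))
  have h2C : (1 : ℝ) ≤ 2 ^ C := Real.one_le_rpow (by norm_num) hC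
  have hA : 1 ≤ 2 * (‖s * (1 - s)‖ + 3) := by linarith [norm_nonneg (s * (1 - s))]
  refine ⟨2 * (‖s * (1 - s)‖ + 3) * (K * 2 ^ C), T + 1, by positivity, by linarith, ?_⟩
  intro z hz
  have hz0 : 0 < z.im := by linarith
  have hM : ∀ w : ℂ, z.im - 1 ≤ w.im → ‖u w‖ ≤ K * 2 ^ C * z.im ^ (-C) := by
    intro w hw
    have hw2 : z.im / 2 ≤ w.im := by linarith
    refine (h w (by linarith)).trans ?_
    rw [mul_assoc]
    refine mul_le_mul_of_nonneg_left ?_ (by linarith)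
    calc w.im ^ (-C) ≤ (z.im / 2) ^ (-C) :=
          Real.rpow_le_rpow_of_nonpos (by linarith) hw2 (by linarith)
      _ = 2 ^ C * z.im ^ (-C) := by
          rw [Real.div_rpow hz0.le (by norm_num), Real.rpow_neg (by norm_num : (0 : ℝ) ≤ 2)]
          field_simp
  have hpos : 0 < K * 2 ^ C * z.im ^ (-C) := by positivity
  obtain ⟨g1, g2⟩ := norm_fderiv_le_of_eigen hu.contDiffOn (fun z hz => hu.eigen z hz)
    (by linarith) hpos hM
  rw [mul_assoc _ _ (z.im ^ (-C))]
  exact ⟨(hM z (by linarith)).trans (le_mul_of_one_le_left hpos.le hA), g1, g2⟩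

/- ## The kernel `R_ζ^s` -/

theorem Rfun_denom_pos (ξ : ℝ) {z : ℂ} (hz : z ∈ upperHalf) :
    0 < (z.re - ξ) ^ 2 + z.im ^ 2 := by
  have : 0 < z.im := hz
  positivity

theorem Rfun_pos (ξ : ℝ) {z : ℂ} (hz : z ∈ upperHalf) : 0 < Rfun ξ z :=
  div_pos hz (Rfun_denom_pos ξ hz)

theorem Rpow_eq_exp (s : ℂ) (ξ : ℝ) {z : ℂ} (hz : z ∈ upperHalf) :
    Rpow s ξ z =
      cexp (((Real.log z.im - Real.log ((z.re - ξ) ^ 2 + z.im ^ 2) : ℝ) : ℂ) * s) := by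
  have hz' : 0 < z.im := hz
  rw [Rpow, cpow_def_of_ne_zero (by exact_mod_cast (Rfun_pos ξ hz).ne'),
    ← ofReal_log (Rfun_pos ξ hz).le, Rfun, Real.log_div hz'.ne' (Rfun_denom_pos ξ hz).ne']

theorem contDiffOn_Rpow (s : ℂ) (ξ : ℝ) : ContDiffOn ℝ 2 (Rpow s ξ) upperHalf := by
  refine ContDiffOn.congr ?_ fun z hz => Rpow_eq_exp s ξ hz
  intro z hz
  have hre : ContDiffAt ℝ 2 (fun w : ℂ => w.re) z := reCLM.contDiff.contDiffAt
  have him : ContDiffAt ℝ 2 (fun w : ℂ => w.im) z := imCLM.contDiff.contDiffAt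
  have hlog : ContDiffAt ℝ 2
      (fun w : ℂ => Real.log w.im - Real.log ((w.re - ξ) ^ 2 + w.im ^ 2)) z :=
    (him.log (ne_of_gt hz)).sub
      ((((hre.sub contDiffAt_const).pow 2).add (him.pow 2)).log (Rfun_denom_pos ξ hz).ne')
  have hof : ContDiffAt ℝ 2 (fun w : ℂ =>
      ((Real.log w.im - Real.log ((w.re - ξ) ^ 2 + w.im ^ 2) : ℝ) : ℂ)) z :=
    ofRealCLM.contDiff.contDiffAt.comp z hlog
  exact ((hof.mul contDiffAt_const).cexp).contDiffWithinAt

theorem hasDerivAt_Rpow_re (s : ℂ) (ξ : ℝ) {x y : ℝ} (hy : 0 < y) :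
    HasDerivAt (fun x : ℝ => Rpow s ξ (x + y * I))
      (Rpow s ξ (x + y * I) * (s * ((-(2 * (x - ξ)) / ((x - ξ) ^ 2 + y ^ 2) : ℝ) : ℂ))) x := by
  have hmem : ∀ x : ℝ, (x + y * I : ℂ) ∈ upperHalf := fun x => by simpa [upperHalf] using hy
  have hQ : (x - ξ) ^ 2 + y ^ 2 ≠ 0 := by positivity
  have hfun : (fun x : ℝ => Rpow s ξ (x + y * I)) = fun x : ℝ =>
      cexp (((Real.log y - Real.log ((x - ξ) ^ 2 + y ^ 2) : ℝ) : ℂ) * s) := by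
    ext x
    rw [Rpow_eq_exp s ξ (hmem x)]; simp
  have hv := congrFun hfun x
  rw [hfun, hv]
  have h1 : HasDerivAt (fun x : ℝ => (x - ξ) ^ 2 + y ^ 2) (2 * (x - ξ)) x := by
    simpa using (((hasDerivAt_id x).sub_const ξ).pow 2).add_const (y ^ 2)
  have h2 := (((h1.log hQ).const_sub (Real.log y)).ofReal_comp.mul_const s).cexp
  refine h2.congr_deriv ?_
  rw [mul_comm s, neg_div]

theorem hasDerivAt_Rpow_im (s : ℂ) (ξ : ℝ) {x y : ℝ} (hy : 0 < y) :
    HasDerivAt (fun y : ℝ => Rpow s ξ (x + y * I))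
      (Rpow s ξ (x + y * I) * (s * ((1 / y - 2 * y / ((x - ξ) ^ 2 + y ^ 2) : ℝ) : ℂ))) y := by
  have hmem : ∀ y : ℝ, 0 < y → (x + y * I : ℂ) ∈ upperHalf := fun y hy => by
    simpa [upperHalf] using hy
  have hQ : (x - ξ) ^ 2 + y ^ 2 ≠ 0 := by positivity
  have hfun : ∀ y : ℝ, 0 < y → Rpow s ξ (x + y * I) =
      cexp (((Real.log y - Real.log ((x - ξ) ^ 2 + y ^ 2) : ℝ) : ℂ) * s) := by
    intro y hy
    rw [Rpow_eq_exp s ξ (hmem y hy)]; simp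
  have h1 : HasDerivAt (fun y : ℝ => (x - ξ) ^ 2 + y ^ 2) (2 * y) y := by
    simpa using (hasDerivAt_pow 2 y).const_add ((x - ξ) ^ 2)
  have h2 := ((((Real.hasDerivAt_log hy.ne').sub (h1.log hQ))).ofReal_comp.mul_const s).cexp
  rw [hfun y hy]
  refine (h2.congr_of_eventuallyEq ?_).congr_deriv ?_
  · filter_upwards [lt_mem_nhds hy] with t ht using hfun t ht
  · rw [mul_comm s, one_div]; rfl

theorem pdx_Rpow (s : ℂ) (ξ : ℝ) {z : ℂ} (hz : z ∈ upperHalf) :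
    pdx (Rpow s ξ) z = Rpow s ξ z *
      (s * ((-(2 * (z.re - ξ)) / ((z.re - ξ) ^ 2 + z.im ^ 2) : ℝ) : ℂ)) := by
  rw [pdx, (hasDerivAt_Rpow_re s ξ hz).deriv, re_add_im]

theorem pdy_Rpow (s : ℂ) (ξ : ℝ) {z : ℂ} (hz : z ∈ upperHalf) :
    pdy (Rpow s ξ) z = Rpow s ξ z *
      (s * ((1 / z.im - 2 * z.im / ((z.re - ξ) ^ 2 + z.im ^ 2) : ℝ) : ℂ)) := by
  rw [pdy, (hasDerivAt_Rpow_im s ξ hz).deriv, re_add_im]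

/-- `R_ξ^s` is an eigenfunction of the hyperbolic Laplacian. -/
theorem laplace_Rpow (s : ℂ) (ξ : ℝ) {z : ℂ} (hz : z ∈ upperHalf) :
    laplace (Rpow s ξ) z = s * (1 - s) * Rpow s ξ z := by
  set x := z.re with hx
  set y := z.im with hy
  have hy0 : 0 < y := hz
  have hQ0 : 0 < (x - ξ) ^ 2 + y ^ 2 := Rfun_denom_pos ξ hz
  set Q := (x - ξ) ^ 2 + y ^ 2 with hQ
  have hmem : ∀ x y : ℝ, 0 < y → (x + y * I : ℂ) ∈ upperHalf := fun x y hy => by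
    simpa [upperHalf] using hy
  have hxx : pdx (pdx (Rpow s ξ)) z = Rpow s ξ z * (s * ((-(2 * (x - ξ)) / Q : ℝ) : ℂ)) *
      (s * ((-(2 * (x - ξ)) / Q : ℝ) : ℂ)) + Rpow s ξ z *
        (s * (((-2 * Q + 4 * (x - ξ) ^ 2) / Q ^ 2 : ℝ) : ℂ)) := by
    have h1 : HasDerivAt (fun x : ℝ => -(2 * (x - ξ)) / ((x - ξ) ^ 2 + y ^ 2))
        ((-2 * Q + 4 * (x - ξ) ^ 2) / Q ^ 2) x := by
      have hn : HasDerivAt (fun x : ℝ => -(2 * (x - ξ))) (-2) x := by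
        exact (((hasDerivAt_id x).sub_const ξ).const_mul 2).neg.congr_deriv (by simp)
      have hd : HasDerivAt (fun x : ℝ => (x - ξ) ^ 2 + y ^ 2) (2 * (x - ξ)) x := by
        simpa using (((hasDerivAt_id x).sub_const ξ).pow 2).add_const (y ^ 2)
      refine (hn.div hd hQ0.ne').congr_deriv ?_
      rw [hQ]; ring
    have h2 := (hasDerivAt_Rpow_re s ξ (x := x) hy0).mul (h1.ofReal_comp.const_mul s)
    have hzz : (x + y * I : ℂ) = z := re_add_im z
    rw [hzz] at h2
    rw [pdx, ← h2.deriv]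
    congr 1
    ext x'
    rw [pdx_Rpow s ξ (hmem x' y hy0)]
    simp
  have hyy : pdy (pdy (Rpow s ξ)) z = Rpow s ξ z * (s * ((1 / y - 2 * y / Q : ℝ) : ℂ)) *
      (s * ((1 / y - 2 * y / Q : ℝ) : ℂ)) + Rpow s ξ z *
        (s * ((-1 / y ^ 2 - (2 * Q - 4 * y ^ 2) / Q ^ 2 : ℝ) : ℂ)) := by
    have h1 : HasDerivAt (fun y : ℝ => 1 / y - 2 * y / ((x - ξ) ^ 2 + y ^ 2))
        (-1 / y ^ 2 - (2 * Q - 4 * y ^ 2) / Q ^ 2) y := by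
      have hn : HasDerivAt (fun y : ℝ => 2 * y) 2 y := by
        simpa using (hasDerivAt_id y).const_mul 2
      have hd : HasDerivAt (fun y : ℝ => (x - ξ) ^ 2 + y ^ 2) (2 * y) y := by
        simpa using (hasDerivAt_pow 2 y).const_add ((x - ξ) ^ 2)
      have hi : HasDerivAt (fun y : ℝ => 1 / y) (-1 / y ^ 2) y := by
        simpa [one_div, neg_div] using hasDerivAt_inv hy0.ne'
      refine (hi.sub (hn.div hd hQ0.ne')).congr_deriv ?_
      rw [hQ]; ring
    have h2 := (hasDerivAt_Rpow_im s ξ (x := x) hy0).mul (h1.ofReal_comp.const_mul s)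
    have hzz : (x + y * I : ℂ) = z := re_add_im z
    rw [hzz] at h2
    rw [pdy, ← h2.deriv]
    refine EventuallyEq.deriv_eq ?_
    filter_upwards [lt_mem_nhds hy0] with y' hy'
    rw [pdy_Rpow s ξ (hmem x y' hy')]
    simp [hx]
  have hyc : (y : ℂ) ≠ 0 := by exact_mod_cast hy0.ne'
  have hQc : (Q : ℂ) ≠ 0 := by exact_mod_cast hQ0.ne'
  have hQe : (Q : ℂ) = (x - ξ) ^ 2 + y ^ 2 := by rw [hQ]; push_cast; ring
  rw [laplace, hxx, hyy]
  push_cast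
  field_simp
  rw [hQe]
  ring

theorem norm_Rpow_le (s : ℂ) (ξ : ℝ) {z : ℂ} {X : ℝ} (hX : |z.re| ≤ X) (hz : 1 ≤ z.im) :
    ‖Rpow s ξ z‖ ≤ (((X + |ξ|) ^ 2 + 1) * z.im) ^ |s.re| := by
  have hzm : z ∈ upperHalf := lt_of_lt_of_le one_pos hz
  have hz0 : 0 < z.im := hzm
  have hR := Rfun_pos ξ hzm
  have hB : 1 ≤ ((X + |ξ|) ^ 2 + 1) * z.im := by nlinarith [sq_nonneg (X + |ξ|)]
  have hsq : (z.re - ξ) ^ 2 ≤ (X + |ξ|) ^ 2 := by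
    rw [← sq_abs (z.re - ξ)]
    refine pow_le_pow_left₀ (abs_nonneg _) ?_ 2
    exact (abs_sub _ _).trans (by linarith)
  have hR1 : Rfun ξ z ≤ 1 := by
    rw [Rfun, div_le_one (Rfun_denom_pos ξ hzm)]
    nlinarith [sq_nonneg (z.re - ξ)]
  have hRinv : (Rfun ξ z)⁻¹ ≤ ((X + |ξ|) ^ 2 + 1) * z.im := by
    rw [Rfun, inv_div, div_le_iff₀ hz0]
    nlinarith [mul_le_mul_of_nonneg_left (one_le_pow₀ hz : 1 ≤ z.im ^ 2) (sq_nonneg (X + |ξ|))]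
  rw [Rpow, norm_cpow_eq_rpow_re_of_pos hR]
  rcases le_total 0 s.re with h | h
  · exact (Real.rpow_le_one hR.le hR1 h).trans (Real.one_le_rpow hB (abs_nonneg _))
  · rw [abs_of_nonpos h, ← neg_neg s.re, Real.rpow_neg hR.le, ← Real.inv_rpow hR.le, neg_neg]
    exact Real.rpow_le_rpow (inv_nonneg.2 hR.le) hRinv (by linarith)

theorem norm_fderiv_Rpow_le (s : ℂ) (ξ : ℝ) {z : ℂ} (hz : 1 ≤ z.im) :
    ‖fderiv ℝ (Rpow s ξ) z 1‖ ≤ ‖s‖ * ‖Rpow s ξ z‖ ∧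
      ‖fderiv ℝ (Rpow s ξ) z I‖ ≤ ‖s‖ * ‖Rpow s ξ z‖ := by
  have hzm : z ∈ upperHalf := lt_of_lt_of_le one_pos hz
  have hz0 : 0 < z.im := hzm
  have hQ := Rfun_denom_pos ξ hzm
  have hd : DifferentiableAt ℝ (Rpow s ξ) z :=
    ((contDiffOn_Rpow s ξ).contDiffAt (isOpen_upperHalf.mem_nhds hzm)).differentiableAt
      (by norm_num)
  have hsq : z.im ≤ z.im ^ 2 := by nlinarith
  rw [← pdx_eq_fderiv hd, ← pdy_eq_fderiv hd, pdx_Rpow s ξ hzm, pdy_Rpow s ξ hzm, norm_mul,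
    norm_mul, norm_mul, norm_mul, norm_real, norm_real, mul_comm]
  constructor
  · refine mul_le_mul_of_nonneg_right (mul_le_of_le_one_right (norm_nonneg _) ?_) (norm_nonneg _)
    rw [Real.norm_eq_abs, abs_div, abs_of_pos hQ, div_le_one hQ, abs_le]
    constructor <;> nlinarith [sq_nonneg (z.re - ξ - 1), sq_nonneg (z.re - ξ + 1)]
  · rw [mul_comm]
    refine mul_le_mul_of_nonneg_right (mul_le_of_le_one_right (norm_nonneg _) ?_) (norm_nonneg _)
    have e : 1 / z.im - 2 * z.im / ((z.re - ξ) ^ 2 + z.im ^ 2) =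
        ((z.re - ξ) ^ 2 - z.im ^ 2) / (z.im * ((z.re - ξ) ^ 2 + z.im ^ 2)) := by
      field_simp; ring
    rw [e, Real.norm_eq_abs, abs_div, abs_of_pos (mul_pos hz0 hQ), div_le_one (mul_pos hz0 hQ),
      abs_le]
    constructor <;> nlinarith [sq_nonneg (z.re - ξ), mul_nonneg (sub_nonneg.2 hz) hQ.le]

/- ## The closed form attached to a pair of eigenfunctions -/

/-- The `1`-form `u ⋆dv - v ⋆du`, where `⋆` is the Hodge star operator. -/
def greenForm (u v : ℂ → ℂ) (z : ℂ) : ℂ →L[ℝ] ℂ :=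
  u z • (fderiv ℝ v z).comp ((-I) • ContinuousLinearMap.id ℝ ℂ) -
    v z • (fderiv ℝ u z).comp ((-I) • ContinuousLinearMap.id ℝ ℂ)

theorem greenForm_apply (u v : ℂ → ℂ) (z h : ℂ) :
    greenForm u v z h = u z * fderiv ℝ v z (-I * h) - v z * fderiv ℝ u z (-I * h) := by
  simp [greenForm]

theorem greenForm_I (u v : ℂ → ℂ) (z : ℂ) :
    greenForm u v z I = u z * fderiv ℝ v z 1 - v z * fderiv ℝ u z 1 := by
  rw [greenForm_apply]; simp

theorem greenForm_one (u v : ℂ → ℂ) (z : ℂ) :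
    greenForm u v z 1 = v z * fderiv ℝ u z I - u z * fderiv ℝ v z I := by
  rw [greenForm_apply]; simp; ring

theorem ContDiffOn.differentiableAt_upperHalf {f : ℂ → ℂ} (hf : ContDiffOn ℝ 2 f upperHalf)
    {z : ℂ} (hz : z ∈ upperHalf) : DifferentiableAt ℝ f z :=
  (hf.contDiffAt (isOpen_upperHalf.mem_nhds hz)).differentiableAt (by norm_num)

theorem ContDiffOn.differentiableAt_fderiv_upperHalf {f : ℂ → ℂ}
    (hf : ContDiffOn ℝ 2 f upperHalf) {z : ℂ} (hz : z ∈ upperHalf) :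
    DifferentiableAt ℝ (fderiv ℝ f) z :=
  ((hf.contDiffAt (isOpen_upperHalf.mem_nhds hz)).fderiv_right (m := 1)
    (by norm_num)).differentiableAt (by norm_num)

theorem differentiableAt_greenForm {u v : ℂ → ℂ} (hu : ContDiffOn ℝ 2 u upperHalf)
    (hv : ContDiffOn ℝ 2 v upperHalf) {z : ℂ} (hz : z ∈ upperHalf) :
    DifferentiableAt ℝ (greenForm u v) z := by
  have h1 := hu.differentiableAt_upperHalf hz
  have h2 := hv.differentiableAt_upperHalf hz
  have h3 := hu.differentiableAt_fderiv_upperHalf hz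
  have h4 := hv.differentiableAt_fderiv_upperHalf hz
  exact (h1.smul (h4.clm_comp (differentiableAt_const _))).sub
    (h2.smul (h3.clm_comp (differentiableAt_const _)))

theorem bilin_symm_of_one_I {β : ℂ →L[ℝ] ℂ →L[ℝ] ℂ} (h : β 1 I = β I 1) (x y : ℂ) :
    β x y = β y x := by
  have hx : ∀ x : ℂ, x = x.re • (1 : ℂ) + x.im • I := fun x => by
    simp [re_add_im]
  rw [hx x, hx y]
  simp only [map_add, map_smul, add_apply, smul_apply, h]
  simp only [real_smul]
  ring

theorem fderiv_greenForm_symm {u v : ℂ → ℂ} {lam : ℂ} (hu : ContDiffOn ℝ 2 u upperHalf)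
    (hv : ContDiffOn ℝ 2 v upperHalf) (hlu : ∀ z ∈ upperHalf, laplace u z = lam * u z)
    (hlv : ∀ z ∈ upperHalf, laplace v z = lam * v z) {z : ℂ} (hz : z ∈ upperHalf) (x y : ℂ) :
    fderiv ℝ (greenForm u v) z x y = fderiv ℝ (greenForm u v) z y x := by
  have h1 := hu.differentiableAt_upperHalf hz
  have h2 := hv.differentiableAt_upperHalf hz
  have h3 := hu.differentiableAt_fderiv_upperHalf hz
  have h4 := hv.differentiableAt_fderiv_upperHalf hz
  have key : ∀ h k : ℂ, fderiv ℝ (greenForm u v) z h k =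
      (fderiv ℝ u z h * fderiv ℝ v z (-I * k) + u z * fderiv ℝ (fderiv ℝ v) z h (-I * k)) -
      (fderiv ℝ v z h * fderiv ℝ u z (-I * k) + v z * fderiv ℝ (fderiv ℝ u) z h (-I * k)) := by
    intro h k
    have e1 : fderiv ℝ (greenForm u v) z h k = fderiv ℝ (fun w => greenForm u v w k) z h := by
      rw [fderiv_clm_apply (differentiableAt_greenForm hu hv hz) (differentiableAt_const k)]
      simp
    have d1 := (h1.hasFDerivAt.mul (h4.hasFDerivAt.clm_apply (hasFDerivAt_const (-I * k) z)))
    have d2 := (h2.hasFDerivAt.mul (h3.hasFDerivAt.clm_apply (hasFDerivAt_const (-I * k) z)))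
    have e2 : (fun w => greenForm u v w k) = (fun w => u w * fderiv ℝ v w (-I * k)) -
        (fun w => v w * fderiv ℝ u w (-I * k)) := by
      ext w; exact greenForm_apply u v w k
    rw [e1, e2]
    refine (congrArg (fun A : ℂ →L[ℝ] ℂ => A h) (d1.sub d2).fderiv).trans ?_
    simp
    ring
  apply bilin_symm_of_one_I
  have hl := hlu z hz
  have hl' := hlv z hz
  rw [laplace_eq_fderiv hu hz] at hl
  rw [laplace_eq_fderiv hv hz] at hl'
  have hz0 : (z.im : ℂ) ≠ 0 := by
    have : 0 < z.im := hz
    exact_mod_cast this.ne'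
  have hz2 : (z.im : ℂ) ^ 2 ≠ 0 := pow_ne_zero 2 hz0
  have hI : -I * I = 1 := by simp
  rw [key, key, hI, mul_one]
  simp only [map_neg]
  have : (z.im : ℂ) ^ 2 * (u z * (fderiv ℝ (fderiv ℝ v) z 1 1 + fderiv ℝ (fderiv ℝ v) z I I) -
      v z * (fderiv ℝ (fderiv ℝ u) z 1 1 + fderiv ℝ (fderiv ℝ u) z I I)) = 0 := by
    linear_combination v z * hl - u z * hl'
  have := (mul_eq_zero.1 this).resolve_left hz2
  linear_combination this

theorem exists_primitive_greenForm {u v : ℂ → ℂ} {lam : ℂ} (hu : ContDiffOn ℝ 2 u upperHalf)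
    (hv : ContDiffOn ℝ 2 v upperHalf) (hlu : ∀ z ∈ upperHalf, laplace u z = lam * u z)
    (hlv : ∀ z ∈ upperHalf, laplace v z = lam * v z) :
    ∃ F : ℂ → ℂ, ∀ z ∈ upperHalf, HasFDerivAt F (greenForm u v z) z :=
  convex_upperHalf.exists_forall_hasFDerivAt_of_fderiv_symmetric isOpen_upperHalf
    (fun _ hz => (differentiableAt_greenForm hu hv hz).differentiableWithinAt)
    fun _ hz => fderiv_greenForm_symm hu hv hlu hlv hz

/-- Conformal invariance: primitives pull back under holomorphic maps. -/
theorem hasFDerivAt_primitive_comp {u v u₁ v₁ F g : ℂ → ℂ} {κ : ℂ}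
    (hu : ContDiffOn ℝ 2 u upperHalf) (hv : ContDiffOn ℝ 2 v upperHalf)
    (hu₁ : ContDiffOn ℝ 2 u₁ upperHalf) (hv₁ : ContDiffOn ℝ 2 v₁ upperHalf)
    (hF : ∀ z ∈ upperHalf, HasFDerivAt F (greenForm u v z) z)
    (hg : ∀ z ∈ upperHalf, g z ∈ upperHalf) (hgd : ∀ z ∈ upperHalf, DifferentiableAt ℂ g z)
    (hug : ∀ z ∈ upperHalf, u (g z) = u₁ z) (hvg : ∀ z ∈ upperHalf, v (g z) = κ * v₁ z)
    {z : ℂ} (hz : z ∈ upperHalf) :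
    HasFDerivAt (fun z => F (g z)) (κ • greenForm u₁ v₁ z) z := by
  have hn := isOpen_upperHalf.mem_nhds hz
  have hgR : HasFDerivAt g ((fderiv ℂ g z).restrictScalars ℝ) z :=
    (hgd z hz).hasFDerivAt.restrictScalars ℝ
  have eu := ((hu.differentiableAt_upperHalf (hg z hz)).hasFDerivAt.comp z hgR)
  have ev := ((hv.differentiableAt_upperHalf (hg z hz)).hasFDerivAt.comp z hgR)
  have eu₁ := (hu₁.differentiableAt_upperHalf hz).hasFDerivAt
  have ev₁ := (hv₁.differentiableAt_upperHalf hz).hasFDerivAt.const_mul κ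
  have eqU := (eu.congr_of_eventuallyEq (f₁ := u₁)
    (by filter_upwards [hn] with w hw using (hug w hw).symm)).unique eu₁
  have eqV := (ev.congr_of_eventuallyEq (f₁ := fun w => κ * v₁ w)
    (by filter_upwards [hn] with w hw using (hvg w hw).symm)).unique ev₁
  have eF := (hF (g z) (hg z hz)).comp z hgR
  refine eF.congr_fderiv ?_
  ext1 h
  have hlin : -I * fderiv ℂ g z h = fderiv ℂ g z (-I * h) := by
    rw [← smul_eq_mul, ← smul_eq_mul, map_smul]
  have eqU' : fderiv ℝ u (g z) (fderiv ℂ g z (-I * h)) = fderiv ℝ u₁ z (-I * h) := by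
    rw [← eqU]; rfl
  have eqV' : fderiv ℝ v (g z) (fderiv ℂ g z (-I * h)) = κ * fderiv ℝ v₁ z (-I * h) :=
    congrArg (fun A : ℂ →L[ℝ] ℂ => A (-I * h)) eqV
  calc greenForm u v (g z) (fderiv ℂ g z h) = κ * greenForm u₁ v₁ z h := by
        rw [greenForm_apply, greenForm_apply, hlin, eqU', eqV', hug z hz, hvg z hz]
        ring

theorem exists_norm_greenForm_le {n : ℕ} {s : ℂ} {u : ℂ → ℂ} (hu : IsCuspForm n s u)
    (ξ X : ℝ) :
    ∃ K T : ℝ, 0 ≤ K ∧ 1 ≤ T ∧ ∀ z : ℂ, |z.re| ≤ X → T ≤ z.im →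
      ‖greenForm u (Rpow s ξ) z 1‖ ≤ K / z.im ^ 2 ∧
      ‖greenForm u (Rpow s ξ) z I‖ ≤ K / z.im ^ 2 := by
  obtain ⟨K, T, hK, hT, h⟩ := hu.exists_decay (C := |s.re| + 2) (by positivity)
  set B := (X + |ξ|) ^ 2 + 1 with hB
  have hB0 : 0 ≤ B := by positivity
  refine ⟨K * B ^ |s.re| * (‖s‖ + 1), T, by positivity, hT, fun z hX hz => ?_⟩
  obtain ⟨h1, h2, h3⟩ := h z hz
  have hz1 := hT.trans hz
  have hz0 : 0 < z.im := by linarith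
  obtain ⟨g1, g2⟩ := norm_fderiv_Rpow_le s ξ hz1
  have hR := norm_Rpow_le s ξ hX hz1
  have hpow : z.im ^ (-(|s.re| + 2)) * (B * z.im) ^ |s.re| = B ^ |s.re| / z.im ^ 2 := by
    rw [Real.mul_rpow hB0 hz0.le, neg_add, Real.rpow_add hz0, Real.rpow_neg hz0.le,
      Real.rpow_neg hz0.le, Real.rpow_two]
    have : z.im ^ |s.re| ≠ 0 := (Real.rpow_pos_of_pos hz0 _).ne'
    field_simp
  have main : ∀ a b c d : ℂ, ‖a‖ ≤ K * z.im ^ (-(|s.re| + 2)) → ‖b‖ ≤ ‖s‖ * ‖Rpow s ξ z‖ →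
      ‖c‖ ≤ ‖Rpow s ξ z‖ → ‖d‖ ≤ K * z.im ^ (-(|s.re| + 2)) →
      ‖a‖ * ‖b‖ + ‖c‖ * ‖d‖ ≤ K * B ^ |s.re| * (‖s‖ + 1) / z.im ^ 2 := by
    intro a b c d ha hb hc hd
    calc ‖a‖ * ‖b‖ + ‖c‖ * ‖d‖
        ≤ K * z.im ^ (-(|s.re| + 2)) * (‖s‖ * (B * z.im) ^ |s.re|) +
          (B * z.im) ^ |s.re| * (K * z.im ^ (-(|s.re| + 2))) := by
          gcongr
          · exact hb.trans (mul_le_mul_of_nonneg_left hR (norm_nonneg _))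
          · exact hc.trans hR
      _ = K * (z.im ^ (-(|s.re| + 2)) * (B * z.im) ^ |s.re|) * (‖s‖ + 1) := by ring
      _ = K * B ^ |s.re| * (‖s‖ + 1) / z.im ^ 2 := by rw [hpow]; ring
  constructor
  · rw [greenForm_one]
    refine (norm_sub_le _ _).trans ?_
    rw [norm_mul, norm_mul, add_comm]
    exact main _ _ _ _ h1 g2 le_rfl h3
  · rw [greenForm_I]
    refine (norm_sub_le _ _).trans ?_
    rw [norm_mul, norm_mul]
    exact main _ _ _ _ h1 g1 le_rfl h2

/- ## Line integrals of forms decaying at the cusp -/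

/-- A continuous `1`-form on the upper half-plane which is `O((Im z)⁻²)` at the cusp `∞`. -/
structure IsCuspidal (ω : ℂ → ℂ →L[ℝ] ℂ) : Prop where
  continuousOn : ContinuousOn ω upperHalf
  decay : ∀ X : ℝ, ∃ K T : ℝ, 0 ≤ K ∧ 1 ≤ T ∧ ∀ z : ℂ, |z.re| ≤ X → T ≤ z.im →
    ‖ω z 1‖ ≤ K / z.im ^ 2 ∧ ‖ω z I‖ ≤ K / z.im ^ 2

theorem IsCuspForm.isCuspidal_greenForm {n : ℕ} {s : ℂ} {u : ℂ → ℂ} (hu : IsCuspForm n s u)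
    (ξ : ℝ) (κ : ℂ) : IsCuspidal fun z => κ • greenForm u (Rpow s ξ) z := by
  constructor
  · intro z hz
    exact ((differentiableAt_greenForm hu.contDiffOn (contDiffOn_Rpow s ξ) hz).continuousAt
      |>.const_smul κ).continuousWithinAt
  · intro X
    obtain ⟨K, T, hK, hT, h⟩ := exists_norm_greenForm_le hu ξ X
    refine ⟨‖κ‖ * K, T, by positivity, hT, fun z hX hz => ?_⟩
    obtain ⟨h1, h2⟩ := h z hX hz
    constructor
    · calc ‖(κ • greenForm u (Rpow s ξ) z) 1‖ = ‖κ‖ * ‖greenForm u (Rpow s ξ) z 1‖ := by simp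
        _ ≤ ‖κ‖ * (K / z.im ^ 2) := by gcongr
        _ = ‖κ‖ * K / z.im ^ 2 := by ring
    · calc ‖(κ • greenForm u (Rpow s ξ) z) I‖ = ‖κ‖ * ‖greenForm u (Rpow s ξ) z I‖ := by simp
        _ ≤ ‖κ‖ * (K / z.im ^ 2) := by gcongr
        _ = ‖κ‖ * K / z.im ^ 2 := by ring

theorem add_mul_I_mem_upperHalf (x : ℝ) {y : ℝ} (hy : 0 < y) : (x + y * I : ℂ) ∈ upperHalf := by
  simpa [upperHalf] using hy

theorem continuousOn_vertical {ω : ℂ → ℂ →L[ℝ] ℂ} (hω : ContinuousOn ω upperHalf) (x : ℝ) :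
    ContinuousOn (fun y : ℝ => ω (x + y * I) I) (Set.Ioi 0) :=
  (hω.comp (by fun_prop : ContinuousOn (fun y : ℝ => (x + y * I : ℂ)) (Set.Ioi 0))
    fun _ hy => add_mul_I_mem_upperHalf x hy).clm_apply continuousOn_const

theorem hasDerivAt_vertical {G : ℂ → ℂ} {ω : ℂ → ℂ →L[ℝ] ℂ}
    (hG : ∀ z ∈ upperHalf, HasFDerivAt G (ω z) z) (x : ℝ) {y : ℝ} (hy : 0 < y) :
    HasDerivAt (fun y : ℝ => G (x + y * I)) (ω (x + y * I) I) y := by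
  have h := hG _ (add_mul_I_mem_upperHalf x hy)
  rw [← h.fderiv]
  exact hasDerivAt_comp_line h.differentiableAt

theorem IsCuspidal.integrableOn_vertical {ω : ℂ → ℂ →L[ℝ] ℂ} (hω : IsCuspidal ω) (x : ℝ)
    {a : ℝ} (ha : 0 < a) : IntegrableOn (fun y : ℝ => ω (x + y * I) I) (Set.Ioi a) := by
  obtain ⟨K, T, hK, hT, h⟩ := hω.decay |x|
  have hc := continuousOn_vertical hω.continuousOn x
  have hsub : Set.Ioi a ⊆ Set.Icc a (max a T) ∪ Set.Ioi (max a T) := fun y hy => by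
    rcases le_or_gt y (max a T) with h | h
    · exact Or.inl ⟨le_of_lt hy, h⟩
    · exact Or.inr h
  refine IntegrableOn.mono_set (IntegrableOn.union ?_ ?_) hsub
  · exact (hc.mono fun y hy => ha.trans_le hy.1).integrableOn_Icc
  · have h0 : 0 < max a T := ha.trans_le (le_max_left _ _)
    refine Integrable.mono' ((integrableOn_Ioi_rpow_of_lt (a := -2) (by norm_num) h0).const_mul K)
      ((hc.mono (Set.Ioi_subset_Ioi h0.le)).aestronglyMeasurable measurableSet_Ioi) ?_
    refine (ae_restrict_iff' measurableSet_Ioi).2 (ae_of_all _ fun y hy => ?_)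
    have hy' : max a T < y := hy
    have hyT : T ≤ y := (le_max_right _ _).trans hy'.le
    have := (h (x + y * I) (by simp) (by simpa using hyT)).2
    rw [Real.rpow_neg (h0.trans hy').le, Real.rpow_two, ← div_eq_mul_inv]
    simpa using this

theorem IsCuspidal.exists_tendsto {G : ℂ → ℂ} {ω : ℂ → ℂ →L[ℝ] ℂ} (hω : IsCuspidal ω)
    (hG : ∀ z ∈ upperHalf, HasFDerivAt G (ω z) z) :
    ∃ Λ : ℂ, ∀ x : ℝ, Tendsto (fun y : ℝ => G (x + y * I)) atTop (𝓝 Λ) := by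
  have h0 := tendsto_limUnder_of_hasDerivAt_of_integrableOn_Ioi
    (fun y hy => hasDerivAt_vertical hG 0 (zero_lt_one.trans hy))
    (hω.integrableOn_vertical 0 one_pos)
  refine ⟨limUnder atTop fun y : ℝ => G ((0 : ℝ) + y * I), fun x => ?_⟩
  obtain ⟨K, T, hK, hT, h⟩ := hω.decay |x|
  have hd : Tendsto (fun y : ℝ => G (x + y * I) - G ((0 : ℝ) + y * I)) atTop (𝓝 0) := by
    have hlim : Tendsto (fun y : ℝ => K / y ^ 2 * |x|) atTop (𝓝 0) := by
      have := (tendsto_const_nhds (x := K)).div_atTop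
        (tendsto_pow_atTop (α := ℝ) (n := 2) two_ne_zero)
      simpa using this.mul_const |x|
    refine squeeze_zero_norm' ?_ hlim
    filter_upwards [eventually_ge_atTop T] with y hy
    have hy0 : 0 < y := by linarith
    have hder : ∀ t ∈ Set.uIcc 0 x, HasDerivWithinAt (fun t : ℝ => G (t + y * I))
        (ω (t + y * I) 1) (Set.uIcc 0 x) t := by
      intro t _
      have hh := hG _ (add_mul_I_mem_upperHalf t hy0)
      have e : (t + y * I : ℂ) = y * I + t * 1 := by ring
      have := hasDerivAt_comp_line (f := G) (z := y * I) (e := 1) (t := t)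
        (by rw [← e]; exact hh.differentiableAt)
      rw [← e, hh.fderiv] at this
      refine (this.congr_of_eventuallyEq (Eventually.of_forall fun r => ?_)).hasDerivWithinAt
      show G _ = G _
      congr 1; ring
    have hbd : ∀ t ∈ Set.uIcc 0 x, ‖ω (t + y * I) 1‖ ≤ K / y ^ 2 := by
      intro t ht
      have htx : |t| ≤ |x| := by
        simpa using Set.abs_sub_left_of_mem_uIcc ht
      simpa using (h (t + y * I) (by simpa using htx) (by simpa using hy)).1
    simpa using (convex_uIcc (0 : ℝ) x).norm_image_sub_le_of_norm_hasDerivWithin_le hder hbd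
      Set.left_mem_uIcc Set.right_mem_uIcc
  simpa using hd.add h0

/-- The integral along a geodesic of a closed form which decays at both of its end points. -/
theorem IsCuspidal.integral_eq_sub {f f' : ℝ → ℂ} {G₁ G₂ : ℂ → ℂ} {ω₁ ω₂ : ℂ → ℂ →L[ℝ] ℂ}
    (hω₁ : IsCuspidal ω₁) (hω₂ : IsCuspidal ω₂)
    (hG₁ : ∀ z ∈ upperHalf, HasFDerivAt G₁ (ω₁ z) z)
    (hG₂ : ∀ z ∈ upperHalf, HasFDerivAt G₂ (ω₂ z) z)
    (hf : ∀ y : ℝ, 0 < y → HasDerivAt f (f' y) y) {x₁ x₂ α β : ℝ} (hα : 0 < α) (hβ : 0 < β)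
    (h₁ : ∀ y : ℝ, 0 < y → f y = G₁ (x₁ + (α * y : ℝ) * I))
    (h₂ : ∀ y : ℝ, 0 < y → f y = G₂ (x₂ + (β / y : ℝ) * I)) {Λ₁ Λ₂ : ℂ}
    (hΛ₁ : Tendsto (fun y : ℝ => G₁ (x₁ + y * I)) atTop (𝓝 Λ₁))
    (hΛ₂ : Tendsto (fun y : ℝ => G₂ (x₂ + y * I)) atTop (𝓝 Λ₂)) :
    IntegrableOn f' (Set.Ioi 0) ∧ ∫ y in Set.Ioi (0 : ℝ), f' y = Λ₁ - Λ₂ := by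
  have d₁ : ∀ y : ℝ, 0 < y → f' y = (α : ℂ) * ω₁ (x₁ + (α * y : ℝ) * I) I := by
    intro y hy
    have hh := (hasDerivAt_vertical hG₁ x₁ (mul_pos hα hy)).scomp y
      ((hasDerivAt_id y).const_mul α)
    have := (hf y hy).unique (hh.congr_of_eventuallyEq (f₁ := f)
      (by filter_upwards [Ioi_mem_nhds hy] with r hr using h₁ r hr))
    simpa using this
  have d₂ : ∀ y : ℝ, 0 < y →
      f' y = ((-β / y ^ 2 : ℝ) : ℂ) * ω₂ (x₂ + (β / y : ℝ) * I) I := by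
    intro y hy
    have hh := (hasDerivAt_vertical hG₂ x₂ (div_pos hβ hy)).scomp y
      ((hasDerivAt_const y β).div (hasDerivAt_id y) hy.ne')
    have := (hf y hy).unique (hh.congr_of_eventuallyEq (f₁ := f)
      (by filter_upwards [Ioi_mem_nhds hy] with r hr using h₂ r hr))
    simpa using this
  have hcont : ContinuousOn f' (Set.Ioi 0) := by
    have hc : ContinuousOn (fun y : ℝ => (α : ℂ) * ω₁ (x₁ + (α * y : ℝ) * I) I) (Set.Ioi 0) :=
      continuousOn_const.mul ((continuousOn_vertical hω₁.continuousOn x₁).comp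
        (by fun_prop : ContinuousOn (fun y : ℝ => α * y) (Set.Ioi 0))
        fun y hy => mul_pos hα hy)
    exact hc.congr fun y hy => d₁ y hy
  obtain ⟨K, T, hK, hT, hb⟩ := hω₂.decay |x₂|
  set a := β / T with ha
  have hT0 : 0 < T := by linarith
  have ha0 : 0 < a := div_pos hβ hT0
  have i₁ : IntegrableOn f' (Set.Ioi a) := by
    have := (integrableOn_Ioi_comp_mul_left_iff (fun y : ℝ => ω₁ (x₁ + y * I) I) a hα).2
      (hω₁.integrableOn_vertical x₁ (mul_pos hα ha0))
    exact IntegrableOn.congr_fun (this.const_mul (α : ℂ))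
      (fun y hy => (d₁ y (ha0.trans hy)).symm) measurableSet_Ioi
  have i₂ : IntegrableOn f' (Set.Ioc 0 a) := by
    refine Integrable.mono' (g := fun _ => K / β) (integrable_const _)
      ((hcont.mono fun y hy => hy.1).aestronglyMeasurable measurableSet_Ioc) ?_
    refine (ae_restrict_iff' measurableSet_Ioc).2 (ae_of_all _ fun y hy => ?_)
    have hy0 : 0 < y := hy.1
    have hTy : T ≤ β / y := by
      rw [le_div_iff₀ hy0, mul_comm]
      exact (le_div_iff₀ hT0).1 hy.2
    have := (hb (x₂ + (β / y : ℝ) * I) (by simp) (by simpa using hTy)).2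
    rw [d₂ y hy0, norm_mul, norm_real, Real.norm_eq_abs, abs_div, abs_neg, abs_of_pos hβ,
      abs_of_pos (pow_pos hy0 2)]
    calc β / y ^ 2 * ‖ω₂ (x₂ + (β / y : ℝ) * I) I‖
        ≤ β / y ^ 2 * (K / (x₂ + (β / y : ℝ) * I : ℂ).im ^ 2) := by gcongr
      _ = β / y ^ 2 * (K / (β / y) ^ 2) := by
          congr 3
          simp only [add_im, mul_im, ofReal_re, ofReal_im, I_re, I_im]
          ring
      _ = K / β := by field_simp
  have hint : IntegrableOn f' (Set.Ioi 0) := by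
    rw [← Set.Ioc_union_Ioi_eq_Ioi ha0.le]
    exact i₂.union i₁
  refine ⟨hint, ?_⟩
  have hlim : Tendsto f atTop (𝓝 Λ₁) := by
    refine (hΛ₁.comp (tendsto_id.const_mul_atTop hα)).congr' ?_
    filter_upwards [eventually_gt_atTop 0] with y hy using (h₁ y hy).symm
  have hlim0 : Tendsto f (𝓝[>] 0) (𝓝 Λ₂) := by
    have h : Tendsto (fun y : ℝ => β / y) (𝓝[>] 0) atTop :=
      tendsto_inv_nhdsGT_zero.const_mul_atTop hβ
    refine (hΛ₂.comp h).congr' ?_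
    filter_upwards [self_mem_nhdsWithin] with y hy using (h₂ y hy).symm
  have main := integral_Ioi_of_hasDerivAt_of_tendsto (f := Function.update f 0 Λ₂) (f' := f')
    (a := 0) (m := Λ₁) ?_ ?_ hint ?_
  · simpa using main
  · rw [continuousWithinAt_update_same]
    convert hlim0 using 2
    simp
  · intro y hy
    refine (hf y hy).congr_of_eventuallyEq ?_
    filter_upwards [Ioi_mem_nhds hy] with r hr using Function.update_of_ne (ne_of_gt hr) _ _
  · refine hlim.congr' ?_
    filter_upwards [eventually_gt_atTop 0] with r hr
      using (Function.update_of_ne (ne_of_gt hr) _ _).symm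

/-- The integrand of `Ptrans` in terms of the Green form. -/
theorem Ptrans_integrand_eq {w : ℂ → ℂ} (hw : ContDiffOn ℝ 2 w upperHalf) (s : ℂ) (ζ : ℝ)
    {z : ℂ} (hz : z ∈ upperHalf) :
    w z * pdx (Rpow s ζ) z - Rpow s ζ z * pdx w z = greenForm w (Rpow s ζ) z I := by
  rw [greenForm_I, pdx_eq_fderiv (hw.differentiableAt_upperHalf hz),
    pdx_eq_fderiv ((contDiffOn_Rpow s ζ).differentiableAt_upperHalf hz)]

/- ## Integer Möbius transformations -/

section Moebius

variable {B : Matrix (Fin 2) (Fin 2) ℤ}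

theorem moeb_denom_ne_zero (hB : 0 < B.det) {z : ℂ} (hz : z ∈ upperHalf) :
    (B 1 0 : ℂ) * z + B 1 1 ≠ 0 := by
  intro h
  have hz0 : z.im ≠ 0 := ne_of_gt hz
  have h1 := congrArg im h
  have h2 := congrArg re h
  simp at h1 h2
  have hc : B 1 0 = 0 := h1.resolve_right hz0
  have hd : B 1 1 = 0 := by simpa [hc] using h2
  simp [Matrix.det_fin_two, hc, hd] at hB

theorem moeb_im (B : Matrix (Fin 2) (Fin 2) ℤ) (z : ℂ) :
    (moeb B z).im = B.det * z.im / normSq ((B 1 0 : ℂ) * z + B 1 1) := by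
  rw [moeb, div_im, ← sub_div, Matrix.det_fin_two]
  simp
  ring

theorem moeb_mem_upperHalf (hB : 0 < B.det) {z : ℂ} (hz : z ∈ upperHalf) :
    moeb B z ∈ upperHalf := by
  have h : (0 : ℝ) < B.det := by exact_mod_cast hB
  show 0 < (moeb B z).im
  rw [moeb_im]
  exact div_pos (mul_pos h hz) (normSq_pos.2 (moeb_denom_ne_zero hB hz))

theorem moeb_mul (A : Matrix (Fin 2) (Fin 2) ℤ) (hB : 0 < B.det) {z : ℂ} (hz : z ∈ upperHalf) :
    moeb (A * B) z = moeb A (moeb B z) := by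
  have h := moeb_denom_ne_zero hB hz
  simp only [moeb, Matrix.mul_apply, Fin.sum_univ_two, Int.cast_add, Int.cast_mul]
  rw [mul_div_assoc', mul_div_assoc', div_add' _ _ _ h, div_add' _ _ _ h,
    div_div_div_cancel_right₀ h]
  congr 1 <;> ring

theorem det_adjugate_fin_two (B : Matrix (Fin 2) (Fin 2) ℤ) : B.adjugate.det = B.det := by
  simp [Matrix.det_adjugate]

theorem moeb_smul_one {k : ℤ} (hk : k ≠ 0) (z : ℂ) :
    moeb (k • (1 : Matrix (Fin 2) (Fin 2) ℤ)) z = z := by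
  have : (k : ℂ) ≠ 0 := by exact_mod_cast hk
  simp [moeb, this]

theorem moeb_moeb_adjugate (hB : 0 < B.det) {z : ℂ} (hz : z ∈ upperHalf) :
    moeb B (moeb B.adjugate z) = z := by
  rw [← moeb_mul _ ((det_adjugate_fin_two B).symm ▸ hB) hz, Matrix.mul_adjugate,
    moeb_smul_one hB.ne']

theorem contDiffOn_moeb (hB : 0 < B.det) : ContDiffOn ℝ 2 (moeb B) upperHalf :=
  have h₁ : ContDiff ℂ 2 fun z : ℂ => (B 0 0 : ℂ) * z + B 0 1 :=
    (contDiff_const.mul contDiff_id).add contDiff_const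
  have h₂ : ContDiff ℂ 2 fun z : ℂ => (B 1 0 : ℂ) * z + B 1 1 :=
    (contDiff_const.mul contDiff_id).add contDiff_const
  (h₁.contDiffOn.div h₂.contDiffOn fun _ hz => moeb_denom_ne_zero hB hz).restrict_scalars ℝ

theorem differentiableAt_moeb (hB : 0 < B.det) {z : ℂ} (hz : z ∈ upperHalf) :
    DifferentiableAt ℂ (moeb B) z :=
  DifferentiableAt.div (by fun_prop) (by fun_prop) (moeb_denom_ne_zero hB hz)

theorem Rfun_eq_div_normSq (ξ : ℝ) (z : ℂ) : Rfun ξ z = z.im / normSq (z - ξ) := by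
  simp [Rfun, normSq_apply, sq]

/-- The action of an integer matrix on the boundary of the upper half-plane. -/
def realMoeb (B : Matrix (Fin 2) (Fin 2) ℤ) (ζ : ℝ) : ℝ :=
  ((B 0 0 : ℝ) * ζ + (B 0 1 : ℝ)) / ((B 1 0 : ℝ) * ζ + (B 1 1 : ℝ))

/-- The automorphy factor of `R_ζ^s`. -/
def autoFactor (s : ℂ) (B : Matrix (Fin 2) (Fin 2) ℤ) (ζ : ℝ) : ℂ :=
  ((B.det / ((B 1 0 : ℝ) * ζ + B 1 1) ^ 2 : ℝ) : ℂ) ^ s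

theorem Rfun_moeb (hB : 0 < B.det) {ζ : ℝ} (hζ : (B 1 0 : ℝ) * ζ + B 1 1 ≠ 0) {z : ℂ}
    (hz : z ∈ upperHalf) :
    Rfun ζ z = B.det / ((B 1 0 : ℝ) * ζ + B 1 1) ^ 2 * Rfun (realMoeb B ζ) (moeb B z) := by
  have h := moeb_denom_ne_zero hB hz
  have hm : (B.det : ℝ) ≠ 0 := by exact_mod_cast hB.ne'
  have hζ' : (B 1 0 : ℂ) * ζ + B 1 1 ≠ 0 := by exact_mod_cast hζ
  have hd : moeb B z - (realMoeb B ζ : ℝ) = (B.det : ℝ) * (z - ζ) /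
      (((B 1 0 : ℂ) * z + B 1 1) * (((B 1 0 : ℝ) * ζ + B 1 1 : ℝ) : ℂ)) := by
    rw [moeb, realMoeb, Matrix.det_fin_two]
    push_cast
    rw [div_sub_div _ _ h hζ']
    congr 1
    ring
  have hzζ : normSq (z - ζ) ≠ 0 := by
    refine (normSq_pos.2 fun h0 => ?_).ne'
    have := congrArg im h0
    simp at this
    exact (ne_of_gt hz : z.im ≠ 0) this
  have hn := (normSq_pos.2 h).ne'
  rw [Rfun_eq_div_normSq, Rfun_eq_div_normSq, hd, moeb_im, normSq_div, normSq_mul, normSq_mul,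
    normSq_ofReal, normSq_ofReal]
  generalize normSq ((B 1 0 : ℂ) * z + B 1 1) = N at hn
  field_simp

theorem Rpow_moeb (s : ℂ) (hB : 0 < B.det) {ζ : ℝ} (hζ : (B 1 0 : ℝ) * ζ + B 1 1 ≠ 0) {z : ℂ}
    (hz : z ∈ upperHalf) :
    Rpow s ζ z = autoFactor s B ζ * Rpow s (realMoeb B ζ) (moeb B z) := by
  have hm : (0 : ℝ) < B.det := by exact_mod_cast hB
  rw [Rpow, Rfun_moeb hB hζ hz, ofReal_mul,
    mul_cpow_ofReal_nonneg (by positivity) (Rfun_pos _ (moeb_mem_upperHalf hB hz)).le]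
  rfl

theorem autoFactor_ne_zero (s : ℂ) (hB : 0 < B.det) {ζ : ℝ}
    (hζ : (B 1 0 : ℝ) * ζ + B 1 1 ≠ 0) : autoFactor s B ζ ≠ 0 := by
  have hm : (0 : ℝ) < B.det := by exact_mod_cast hB
  have : B.det / ((B 1 0 : ℝ) * ζ + B 1 1) ^ 2 ≠ 0 := by positivity
  rw [autoFactor, cpow_ne_zero_iff]
  exact Or.inl (ofReal_ne_zero.2 this)

theorem slashTerm_eq (s : ℂ) {m : ℕ} (hm : 1 ≤ m) (f : ℝ → ℂ) (hB : B.det = m) {ζ : ℝ}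
    (hζ : 0 < (B 1 0 : ℝ) * ζ + B 1 1) :
    slashTerm s m f B ζ = autoFactor s B ζ * f (realMoeb B ζ) := by
  have hm' : (0 : ℝ) < m := by exact_mod_cast hm
  rw [slashTerm, autoFactor, realMoeb, hB]
  congr 1
  set t := (B 1 0 : ℝ) * ζ + B 1 1
  have h : (((m : ℤ) : ℝ) / t ^ 2 : ℝ) = (m : ℝ) * (t⁻¹ * t⁻¹) := by
    push_cast; field_simp
  have ht : 0 ≤ t⁻¹ := (inv_pos.2 hζ).le
  rw [h, ofReal_mul, mul_cpow_ofReal_nonneg hm'.le (mul_nonneg ht ht), ofReal_mul,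
    mul_cpow_ofReal_nonneg ht ht, ofReal_natCast, ofReal_inv, ← ofReal_natCast,
    inv_cpow _ _ (by rw [arg_ofReal_of_nonneg hζ.le]; exact Real.pi_pos.ne), ← cpow_neg,
    ← cpow_add _ _ (ofReal_ne_zero.2 hζ.ne')]
  congr 2
  ring

end Moebius

/- ## Hecke translates of cusp forms -/

theorem IsCuspForm.comp_of_det_eq_one {s : ℂ} {u : ℂ → ℂ} (hu : IsCuspForm 1 s u)
    {g : Matrix (Fin 2) (Fin 2) ℤ} (hg : g.det = 1) {z : ℂ} (hz : z ∈ upperHalf) :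
    u (moeb g z) = u z :=
  hu.invar ⟨g, hg⟩ (one_dvd _ : ((1 : ℕ) : ℤ) ∣ _) z hz

/-- `B` is an integer matrix of determinant `m` with `u ∘ B = w`, and `B ζ ≠ ∞`. -/
structure IsTransport (u w : ℂ → ℂ) (m : ℕ) (ζ : ℝ) (B : Matrix (Fin 2) (Fin 2) ℤ) :
    Prop where
  det_eq : B.det = m
  comp_eq : ∀ z ∈ upperHalf, u (moeb B z) = w z
  denom_ne : (B 1 0 : ℝ) * ζ + B 1 1 ≠ 0

section Transport

variable {s : ℂ} {u w F : ℂ → ℂ} {m : ℕ} {ζ : ℝ} {B : Matrix (Fin 2) (Fin 2) ℤ}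

theorem IsTransport.det_pos (hB : IsTransport u w m ζ B) (hm : 1 ≤ m) : 0 < B.det := by
  rw [hB.det_eq]; exact_mod_cast hm

theorem IsTransport.mul_left (hB : IsTransport u w m ζ B) (hu : IsCuspForm 1 s u) (hm : 1 ≤ m)
    {g : Matrix (Fin 2) (Fin 2) ℤ} (hg : g.det = 1)
    (h : ((g * B) 1 0 : ℝ) * ζ + ((g * B) 1 1 : ℤ) ≠ 0) : IsTransport u w m ζ (g * B) where
  det_eq := by rw [Matrix.det_mul, hg, one_mul, hB.det_eq]
  comp_eq z hz := by
    have hd := hB.det_pos hm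
    rw [moeb_mul g hd hz, hu.comp_of_det_eq_one hg (moeb_mem_upperHalf hd hz), hB.comp_eq z hz]
  denom_ne := h

theorem IsTransport.hasFDerivAt (hB : IsTransport u w m ζ B) (hm : 1 ≤ m)
    (hu : ContDiffOn ℝ 2 u upperHalf) (hw : ContDiffOn ℝ 2 w upperHalf)
    (hF : ∀ z ∈ upperHalf, HasFDerivAt F (greenForm w (Rpow s ζ) z) z) :
    ∀ z ∈ upperHalf, HasFDerivAt (fun z => F (moeb B.adjugate z))
      (autoFactor s B ζ • greenForm u (Rpow s (realMoeb B ζ)) z) z := by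
  have hd := hB.det_pos hm
  have hd' : 0 < B.adjugate.det := (det_adjugate_fin_two B).symm ▸ hd
  intro z hz
  refine hasFDerivAt_primitive_comp hw (contDiffOn_Rpow s ζ) hu (contDiffOn_Rpow s _) hF
    (fun z hz => moeb_mem_upperHalf hd' hz) (fun z hz => differentiableAt_moeb hd' hz)
    (fun z hz => ?_) (fun z hz => ?_) hz
  · rw [← hB.comp_eq _ (moeb_mem_upperHalf hd' hz), moeb_moeb_adjugate hd hz]
  · rw [Rpow_moeb s hd hB.denom_ne (moeb_mem_upperHalf hd' hz), moeb_moeb_adjugate hd hz]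

theorem moeb_adjugate_eq_of_row_eq {B' : Matrix (Fin 2) (Fin 2) ℤ} (hm : 1 ≤ m)
    (hB : B.det = m) (hB' : B'.det = m) (h0 : B' 1 0 = B 1 0) (h1 : B' 1 1 = B 1 1) :
    ∃ r : ℝ, ∀ z : ℂ, moeb B'.adjugate z = moeb B.adjugate (z + r) := by
  have hm' : (m : ℂ) ≠ 0 := by exact_mod_cast (by omega : m ≠ 0)
  rw [Matrix.det_fin_two] at hB hB'
  rw [h0, h1] at hB'
  have e : (B 0 0 : ℂ) * B 1 1 - B 0 1 * B 1 0 = m := by exact_mod_cast hB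
  have e' : (B' 0 0 : ℂ) * B 1 1 - B' 0 1 * B 1 0 = m := by exact_mod_cast hB'
  refine ⟨((B' 0 0 : ℝ) * B 0 1 - B' 0 1 * B 0 0) / m, fun z => ?_⟩
  simp only [moeb, Matrix.adjugate_fin_two, Matrix.of_apply, Matrix.cons_val', Matrix.cons_val_zero,
    Matrix.cons_val_one, Matrix.cons_val_fin_one, h0, h1]
  push_cast
  congr 1
  · field_simp
    linear_combination (B' 0 1 : ℂ) * e - (B 0 1 : ℂ) * e'
  · field_simp
    linear_combination (B 0 0 : ℂ) * e' - (B' 0 0 : ℂ) * e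

/-- The limit of the transported primitive at the cusp depends only on the bottom row. -/
theorem exists_rowLimit (hu : IsCuspForm 1 s u) (hm : 1 ≤ m)
    (hw : ContDiffOn ℝ 2 w upperHalf)
    (hF : ∀ z ∈ upperHalf, HasFDerivAt F (greenForm w (Rpow s ζ) z) z) :
    ∃ Λ : ℤ → ℤ → ℂ, ∀ B, IsTransport u w m ζ B → ∀ x : ℝ,
      Tendsto (fun y : ℝ => F (moeb B.adjugate (x + y * I))) atTop (𝓝 (Λ (B 1 0) (B 1 1))) := by
  have key : ∀ c d : ℤ, ∃ L : ℂ, ∀ B, IsTransport u w m ζ B → B 1 0 = c → B 1 1 = d →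
      ∀ x : ℝ, Tendsto (fun y : ℝ => F (moeb B.adjugate (x + y * I))) atTop (𝓝 L) := by
    intro c d
    by_cases h : ∃ B, IsTransport u w m ζ B ∧ B 1 0 = c ∧ B 1 1 = d
    · obtain ⟨B, hB, hc, hd⟩ := h
      obtain ⟨L, hL⟩ := (hu.isCuspidal_greenForm (realMoeb B ζ) (autoFactor s B ζ)).exists_tendsto
        (hB.hasFDerivAt hm hu.contDiffOn hw hF)
      refine ⟨L, fun B' hB' hc' hd' x => ?_⟩
      obtain ⟨r, hr⟩ := moeb_adjugate_eq_of_row_eq hm hB.det_eq hB'.det_eq (hc'.trans hc.symm)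
        (hd'.trans hd.symm)
      refine (hL (x + r)).congr fun y => ?_
      rw [hr]
      congr 2
      push_cast; ring
    · exact ⟨0, fun B hB hc hd => absurd ⟨B, hB, hc, hd⟩ h⟩
  choose Λ hΛ using key
  exact ⟨Λ, fun B hB => hΛ _ _ B hB rfl rfl⟩

variable {Λ : ℤ → ℤ → ℂ}

theorem slashTerm_Ptrans_eq (hu : IsCuspForm 1 s u) (hm : 1 ≤ m)
    (hw : ContDiffOn ℝ 2 w upperHalf)
    (hF : ∀ z ∈ upperHalf, HasFDerivAt F (greenForm w (Rpow s ζ) z) z)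
    (hΛ : ∀ B, IsTransport u w m ζ B → ∀ x : ℝ,
      Tendsto (fun y : ℝ => F (moeb B.adjugate (x + y * I))) atTop (𝓝 (Λ (B 1 0) (B 1 1))))
    (hB : IsTransport u w m ζ B) (h0 : 0 < (B 0 0 : ℝ) * ζ + B 0 1)
    (h1 : 0 < (B 1 0 : ℝ) * ζ + B 1 1) :
    slashTerm s m (Ptrans s u) B ζ = Λ (B 1 0) (B 1 1) - Λ (B 0 0) (B 0 1) := by
  set S : Matrix (Fin 2) (Fin 2) ℤ := !![0, -1; 1, 0] with hS
  have e10 : (S * B) 1 0 = B 0 0 := by simp [hS, Matrix.mul_apply, Fin.sum_univ_two]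
  have e11 : (S * B) 1 1 = B 0 1 := by simp [hS, Matrix.mul_apply, Fin.sum_univ_two]
  have e00 : (S * B) 0 0 = -B 1 0 := by simp [hS, Matrix.mul_apply, Fin.sum_univ_two]
  have e01 : (S * B) 0 1 = -B 1 1 := by simp [hS, Matrix.mul_apply, Fin.sum_univ_two]
  have hSB : IsTransport u w m ζ (S * B) :=
    hB.mul_left hu hm (by simp [hS, Matrix.det_fin_two]) (by rw [e10, e11]; exact h0.ne')
  have hG := hB.hasFDerivAt hm hu.contDiffOn hw hF
  have hG' := hSB.hasFDerivAt hm hu.contDiffOn hw hF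
  have main := (hu.isCuspidal_greenForm (realMoeb B ζ) (autoFactor s B ζ)).integral_eq_sub
    (hu.isCuspidal_greenForm (realMoeb (S * B) ζ) (autoFactor s (S * B) ζ)) hG hG'
    (f := fun y : ℝ => F (moeb B.adjugate ((0 : ℝ) + y * I)))
    (x₁ := 0) (x₂ := 0) (fun y hy => hasDerivAt_vertical hG 0 hy) one_pos one_pos
    (fun y hy => by rw [one_mul]) (fun y hy => ?_) (hΛ B hB 0) (hΛ _ hSB 0)
  · rw [e10, e11] at main
    rw [slashTerm_eq s hm _ hB.det_eq h1, ← main.2, Ptrans, ← integral_const_mul]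
    refine setIntegral_congr_fun measurableSet_Ioi fun y hy => ?_
    have hmem := add_mul_I_mem_upperHalf 0 hy
    rw [ofReal_zero, zero_add] at hmem
    simp only [ofReal_zero, zero_add]
    rw [Ptrans_integrand_eq hu.contDiffOn s _ hmem]
    rfl
  · have hy' : (y : ℂ) ≠ 0 := by exact_mod_cast hy.ne'
    have hne := moeb_denom_ne_zero ((det_adjugate_fin_two B).symm ▸ hB.det_pos hm)
      (add_mul_I_mem_upperHalf 0 hy)
    have hne' := moeb_denom_ne_zero ((det_adjugate_fin_two (S * B)).symm ▸ hSB.det_pos hm)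
      (add_mul_I_mem_upperHalf 0 (one_div_pos.2 hy))
    congr 1
    rw [moeb, moeb, div_eq_div_iff hne hne']
    simp only [Matrix.adjugate_fin_two, Matrix.of_apply, Matrix.cons_val', Matrix.cons_val_zero,
      Matrix.cons_val_one, Matrix.cons_val_fin_one, e00, e01, e10, e11]
    push_cast
    field_simp
    ring_nf
    simp only [I_sq]
    ring

end Transport

theorem moeb_upperTriangular (a b d : ℕ) (z : ℂ) :
    moeb !![(a : ℤ), (b : ℤ); 0, (d : ℤ)] z = ((a : ℂ) * z + b) / d := by
  simp [moeb]

/-- Contribution of the representative `[[a, b], [0, d]]` of the Hecke operator. -/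
theorem sum_slashTerm_mMat_eq {s : ℂ} {u : ℂ → ℂ} (hu : IsCuspForm 1 s u) {m a b d : ℕ}
    (hm : 1 ≤ m) (had : a * d = m) (hb : b < d) {ζ : ℝ} (hζ : 0 < ζ) :
    ContDiffOn ℝ 2 (fun z => u (((a : ℂ) * z + b) / d)) upperHalf ∧
    IntegrableOn (fun y : ℝ =>
      greenForm (fun z => u (((a : ℂ) * z + b) / d)) (Rpow s ζ) (y * I) I) (Set.Ioi 0) ∧
    ∑ l ∈ Finset.Icc 1 (fL ((((b : ℚ) / (d : ℚ) : ℚ) : ℝ) : EReal)),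
      slashTerm s m (Ptrans s u)
        (mMat ((b : ℚ) / (d : ℚ)) l * !![(a : ℤ), (b : ℤ); 0, (d : ℤ)]) ζ =
    ∫ y in Set.Ioi (0 : ℝ),
      greenForm (fun z => u (((a : ℂ) * z + b) / d)) (Rpow s ζ) (y * I) I := by
  set A : Matrix (Fin 2) (Fin 2) ℤ := !![(a : ℤ), (b : ℤ); 0, (d : ℤ)] with hA
  set w : ℂ → ℂ := fun z => u (((a : ℂ) * z + b) / d)
  have hd0 : 0 < d := by omega
  have ha0 : 0 < a := Nat.pos_of_ne_zero fun h => by simp [h] at had; omega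
  have hdR : (0 : ℝ) < d := by exact_mod_cast hd0
  have haR : (0 : ℝ) < a := by exact_mod_cast ha0
  have hdC : (d : ℂ) ≠ 0 := by exact_mod_cast hd0.ne'
  have haC : (a : ℂ) ≠ 0 := by exact_mod_cast ha0.ne'
  have hAw : ∀ z, u (moeb A z) = w z := fun z => by rw [hA, moeb_upperTriangular]
  have hTA : IsTransport u w m ζ A :=
    ⟨by simp [hA, Matrix.det_fin_two, ← had], fun z _ => hAw z, by simpa [hA] using hd0.ne'⟩
  have hdet := hTA.det_pos hm
  have hw : ContDiffOn ℝ 2 w upperHalf :=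
    (hu.contDiffOn.comp (contDiffOn_moeb hdet) fun z hz => moeb_mem_upperHalf hdet hz).congr
      fun z _ => (hAw z).symm
  obtain ⟨F, hF⟩ : ∃ F : ℂ → ℂ, ∀ z ∈ upperHalf, HasFDerivAt F (greenForm w (Rpow s ζ) z) z := by
    obtain ⟨F₀, hF₀⟩ := exists_primitive_greenForm hu.contDiffOn
      (contDiffOn_Rpow s (realMoeb A ζ)) hu.eigen fun z hz => laplace_Rpow s _ hz
    have hκ := autoFactor_ne_zero s hdet hTA.denom_ne
    refine ⟨fun z => autoFactor s A ζ • F₀ (moeb A z), fun z hz => ?_⟩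
    have := (hasFDerivAt_primitive_comp (κ := (autoFactor s A ζ)⁻¹) hu.contDiffOn
      (contDiffOn_Rpow s (realMoeb A ζ)) hw (contDiffOn_Rpow s ζ) hF₀
      (fun z hz => moeb_mem_upperHalf hdet hz) (fun z hz => differentiableAt_moeb hdet hz)
      (fun z _ => hAw z)
      (fun z hz => by rw [Rpow_moeb s hdet hTA.denom_ne hz, inv_mul_cancel_left₀ hκ])
      hz).const_smul (autoFactor s A ζ)
    rwa [smul_inv_smul₀ hκ] at this
  obtain ⟨Λ, hΛ⟩ := exists_rowLimit (ζ := ζ) hu hm hw hF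
  set q : ℚ := (b : ℚ) / d with hq
  have hq0 : 0 ≤ q := by positivity
  have hq1 : q < 1 := by
    rw [hq, div_lt_one (by exact_mod_cast hd0)]; exact_mod_cast hb
  have hmul : ∀ p r p' r' : ℤ, !![p, r; p', r'] * A =
      !![p * a, p * b + r * d; p' * a, p' * b + r' * d] := fun p r p' r' => by
    simp [hA]
  have hrow : ∀ p r : ℤ, 0 ≤ p → (0 < p ∨ r < 0) → (r : ℚ) ≤ q * p →
      0 < ((p * a : ℤ) : ℝ) * ζ + ((p * b + -r * d : ℤ) : ℝ) := by
    intro p r hp hpr hr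
    rw [hq, div_mul_eq_mul_div, le_div_iff₀ (by exact_mod_cast hd0)] at hr
    have hr' : r * d ≤ b * p := by exact_mod_cast hr
    rcases hp.eq_or_lt with rfl | hp
    · have hr0 : r < 0 := hpr.resolve_left (lt_irrefl _)
      have : 0 < -r * (d : ℤ) := by apply mul_pos <;> omega
      simpa using (by exact_mod_cast this : (0 : ℝ) < ((-r * d : ℤ) : ℝ))
    · have h1 : (0 : ℝ) < ((p * a : ℤ) : ℝ) := by
        have : 0 < p * (a : ℤ) := by positivity
        exact_mod_cast this
      have h2 : (0 : ℝ) ≤ ((p * b + -r * d : ℤ) : ℝ) := by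
        have : 0 ≤ p * (b : ℤ) + -r * d := by linarith
        exact_mod_cast this
      have := mul_pos h1 hζ
      linarith
  have hsum := sum_mMat_eq_sub (q₀ := q) hq0
    (fun M => slashTerm s m (Ptrans s u) (M * A) ζ)
    (fun c e => Λ (c * a) (c * b + e * d)) ?_ hq0 hq1 le_rfl
  · have hqr : (q.den : ℤ) * b + -q.num * d = 0 := by
      have h := Rat.num_div_den q
      rw [hq, div_eq_div_iff (by exact_mod_cast q.den_nz) (by exact_mod_cast hd0.ne'), ← hq] at h
      have h' : q.num * d = (b : ℤ) * q.den := by exact_mod_cast h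
      linarith
    have hden : (0 : ℤ) < q.den := by exact_mod_cast q.den_pos
    obtain ⟨x, y, hxy⟩ : IsCoprime q.num (q.den : ℤ) := q.isCoprime_num_den
    set g : Matrix (Fin 2) (Fin 2) ℤ := !![-x, -y; q.den, -q.num] with hg
    have hgdet : g.det = 1 := by
      rw [hg, Matrix.det_fin_two_of]; linarith
    have hgA : g * A = !![-x * a, -x * b + -y * d; q.den * a, 0] := by rw [hg, hmul, hqr]
    have hca : (0 : ℤ) < q.den * a := by positivity
    have hcaR : (0 : ℝ) < ((q.den * a : ℤ) : ℝ) := by exact_mod_cast hca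
    have hTgA : IsTransport u w m ζ (g * A) := by
      refine hTA.mul_left hu hm hgdet ?_
      rw [hgA]
      simpa using ⟨ha0.ne', hζ.ne'⟩
    have hdetgA := hTgA.det_eq
    set e : ℤ := -x * b + -y * d with he
    rw [hgA, Matrix.det_fin_two_of] at hdetgA
    have hbc : -e * (q.den * a) = m := by linarith
    have he0 : 0 < -e := by
      by_contra! h
      nlinarith
    have heR : (0 : ℝ) < ((-e : ℤ) : ℝ) := by exact_mod_cast he0
    have hcaC : ((q.den * a : ℤ) : ℂ) ≠ 0 := by exact_mod_cast hca.ne'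
    have heC : ((-e : ℤ) : ℂ) ≠ 0 := by exact_mod_cast he0.ne'
    have main := (hu.isCuspidal_greenForm (realMoeb A ζ) (autoFactor s A ζ)).integral_eq_sub
      (hu.isCuspidal_greenForm (realMoeb (g * A) ζ) (autoFactor s (g * A) ζ))
      (hTA.hasFDerivAt hm hu.contDiffOn hw hF) (hTgA.hasFDerivAt hm hu.contDiffOn hw hF)
      (f := fun y : ℝ => F ((0 : ℝ) + y * I))
      (x₁ := b / d) (x₂ := ((-x * a : ℤ) : ℝ) / ((q.den * a : ℤ) : ℝ))
      (fun y hy => hasDerivAt_vertical hF 0 hy) (div_pos haR hdR) (div_pos heR hcaR)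
      (fun y hy => ?_) (fun y hy => ?_) (hΛ A hTA _) (hΛ _ hTgA _)
    · simp only [ofReal_zero, zero_add] at main
      refine ⟨hw, main.1, ?_⟩
      rw [main.2]
      refine hsum.trans ?_
      rw [hgA, hqr, hA]
      simp
    · rw [hA, Matrix.adjugate_fin_two_of, moeb]
      congr 1
      simp
      field_simp
      ring
    · rw [hgA, Matrix.adjugate_fin_two_of, moeb]
      have hy' : (y : ℂ) ≠ 0 := by exact_mod_cast hy.ne'
      congr 1
      generalize (q.den : ℤ) * a = c at hcaC
      simp only [Matrix.of_apply, Matrix.cons_val', Matrix.cons_val_zero, Matrix.cons_val_one,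
        Matrix.cons_val_fin_one]
      push_cast at hcaC heC ⊢
      have hden' : (-c : ℂ) * (-x * a / c + -e / c / y * I) + -x * a = e / y * I := by
        field_simp
        ring
      rw [hden', eq_div_iff (by simpa [hy'] using heC)]
      field_simp
      ring_nf
      simp
  · intro p r p' r' hr hr' hdet1 hpr hpr'
    have hM : !![r, -p; r', -p'] * A =
        !![r * a, r * b + -p * d; r' * a, r' * b + -p' * d] := hmul _ _ _ _
    have h1 := hrow r p hr.le (Or.inl hr) hpr
    have h2 := hrow r' p' hr' (by
      by_contra! h
      obtain rfl : r' = 0 := le_antisymm h.1 hr'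
      nlinarith [mul_nonneg h.2 hr.le]) hpr'
    have hT : IsTransport u w m ζ (!![r, -p; r', -p'] * A) := by
      refine hTA.mul_left hu hm (by rw [Matrix.det_fin_two_of]; linarith) ?_
      rw [hM]
      exact h2.ne'
    rw [hM] at hT
    simp only [hM]
    exact slashTerm_Ptrans_eq hu hm hw hF hΛ hT h1 h2

/-- Additivity of `Ptrans`. -/
theorem Ptrans_sum {ι : Type*} (t : Finset ι) {s : ℂ} {ζ : ℝ} {w : ι → ℂ → ℂ}
    (hw : ∀ i ∈ t, ContDiffOn ℝ 2 (w i) upperHalf)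
    (hi : ∀ i ∈ t, IntegrableOn (fun y : ℝ => greenForm (w i) (Rpow s ζ) (y * I) I) (Set.Ioi 0)) :
    Ptrans s (fun z => ∑ i ∈ t, w i z) ζ =
      ∑ i ∈ t, ∫ y in Set.Ioi (0 : ℝ), greenForm (w i) (Rpow s ζ) (y * I) I := by
  have hsum : ContDiffOn ℝ 2 (fun z => ∑ i ∈ t, w i z) upperHalf := ContDiffOn.sum hw
  rw [← integral_finsetSum t hi, Ptrans]
  refine setIntegral_congr_fun measurableSet_Ioi fun y hy => ?_
  have hmem := add_mul_I_mem_upperHalf 0 hy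
  rw [ofReal_zero, zero_add] at hmem
  rw [Ptrans_integrand_eq hsum s ζ hmem, greenForm_I,
    fderiv_fun_sum fun i h => (hw i h).differentiableAt_upperHalf hmem]
  simp only [greenForm_I, sum_apply, Finset.sum_sub_distrib, Finset.sum_mul, Finset.mul_sum]

end

/-- `(Pu)|_s H̃(m) = P(H_m u)` on `(0,∞)`, where
`H̃(m) = Σ_{d∣m, 0≤b<d} M(b/d)·[[m/d,b],[0,d]]` and
`H_m u(z) = Σ_{ad=m, 0≤b<d} u((az+b)/d)`:
for all `ζ > 0`, the sum over all matrices `[[a',b'],[c',d']]` occurring in `H̃(m)`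
of `m^s (c'ζ+d')^{-2s} Pu((a'ζ+b')/(c'ζ+d'))` equals `P(H_m u)(ζ)`. -/
theorem stmt19 (s : ℂ) (u : ℂ → ℂ) (hu : IsCuspForm 1 s u) (m : ℕ) (hm : 1 ≤ m) :
    ∀ ζ : ℝ, 0 < ζ →
      (∑ d ∈ m.divisors, ∑ b ∈ Finset.range d,
        ∑ l ∈ Finset.Icc 1 (fL ((((b : ℚ) / (d : ℚ) : ℚ) : ℝ) : EReal)),
          slashTerm s m (Ptrans s u)
            (mMat ((b : ℚ) / (d : ℚ)) l * !![((m / d : ℕ) : ℤ), (b : ℤ); 0, (d : ℤ)]) ζ)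
      = Ptrans s (fun z => ∑ d ∈ m.divisors, ∑ b ∈ Finset.range d,
          u ((((m / d : ℕ) : ℂ) * z + (b : ℂ)) / ((d : ℕ) : ℂ))) ζ := by
  intro ζ hζ
  have key : ∀ i ∈ m.divisors.sigma Finset.range, _ := fun i hi =>
    sum_slashTerm_mMat_eq hu hm
      (Nat.div_mul_cancel (Nat.dvd_of_mem_divisors (Finset.mem_sigma.1 hi).1))
      (Finset.mem_range.1 (Finset.mem_sigma.1 hi).2) hζ
  have hH : (fun z => ∑ d ∈ m.divisors, ∑ b ∈ Finset.range d,
      u ((((m / d : ℕ) : ℂ) * z + (b : ℂ)) / ((d : ℕ) : ℂ))) =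
      fun z => ∑ i ∈ m.divisors.sigma Finset.range,
        u ((((m / i.1 : ℕ) : ℂ) * z + (i.2 : ℂ)) / ((i.1 : ℕ) : ℂ)) := by
    ext z
    rw [Finset.sum_sigma']
  rw [hH, Finset.sum_sigma', Ptrans_sum _ (fun i hi => (key i hi).1) fun i hi => (key i hi).2.1]
  exact Finset.sum_congr rfl fun i hi => (key i hi).2.2

end
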